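/- arXiv:2408.05015 — 2 statements merged into one kernel-verified Lean document; each statement's English description precedes it below -/
import Mathlib

section
/- Fix a point X of F_q^{n+1} and i ∈ {1,…,n+1}. Then the number of maximal flags of F_q^{n+1} that have type i with respect to X equals c(n−1)·q^{i−1}, i.e. |C_i^X| = q^{i−1}·∏_{k=1}^{n−1} (q^{k+1}−1)/(q−1). -/
/-- A maximal flag in `F^(n+1)`: a chain `U 0 ⊆ U 1 ⊆ ⋯ ⊆ U (n+1)` of subspaces with
`dim (U k) = k`; automatically `U 0 = ⊥` and `U (n+1) = ⊤`, and the chain is strictly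
increasing, so this encodes the chain `U_1 ⊂ ⋯ ⊂ U_n` of the paper. -/
def MaxFlagA (F : Type) [Field F] (n : ℕ) : Type :=
  {U : Fin (n + 2) → Submodule F (Fin (n + 1) → F) //
    Monotone U ∧ ∀ k : Fin (n + 2), Module.finrank F (U k) = (k : ℕ)}

/-- The `k`-th member of the flag, as a function of `k : ℕ` (equal to `⊤` out of range). -/
noncomputable def flagMemA {F : Type} [Field F] {n : ℕ} (c : MaxFlagA F n) (k : ℕ) :
    Submodule F (Fin (n + 1) → F) :=
  if h : k < n + 2 then c.1 ⟨k, h⟩ else ⊤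

/-- The type of a maximal flag with respect to a point `X`: the smallest `k` with
`X ⊆ U k`. -/
noncomputable def flagTypeA {F : Type} [Field F] {n : ℕ} (c : MaxFlagA F n)
    (X : Submodule F (Fin (n + 1) → F)) : ℕ :=
  sInf {k : ℕ | X ≤ flagMemA c k}

/-- The linear automorphisms of a finite-dimensional space act transitively on nonzero vectors. -/
theorem exists_linearEquiv_map_eq_of_ne_zero {K V : Type*} [Field K] [AddCommGroup V] [Module K V]
    [FiniteDimensional K V] {x y : V} (hx : x ≠ 0) (hy : y ≠ 0) : ∃ g : V ≃ₗ[K] V, g x = y := by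
  obtain ⟨g, hg⟩ := Submodule.exists_linearEquiv_restrict_eq
    ((LinearEquiv.toSpanNonzeroSingleton K V x hx).symm ≪≫ₗ
      LinearEquiv.toSpanNonzeroSingleton K V y hy)
  refine ⟨g, ?_⟩
  have h := hg ⟨x, Submodule.mem_span_singleton_self x⟩
  have h1 : (LinearEquiv.toSpanNonzeroSingleton K V x hx).symm
      ⟨x, Submodule.mem_span_singleton_self x⟩ = 1 := by
    rw [LinearEquiv.symm_apply_eq, LinearEquiv.toSpanNonzeroSingleton_one]
  simpa [h1] using h.symm

namespace MaxFlagA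

variable {F : Type} [Field F] {n : ℕ}

instance [Finite F] : Finite (MaxFlagA F n) :=
  inferInstanceAs (Finite {U : Fin (n + 2) → Submodule F (Fin (n + 1) → F) //
    Monotone U ∧ ∀ k : Fin (n + 2), Module.finrank F (U k) = (k : ℕ)})

/-- The vectors lying in the `(j+1)`-st but not in the `j`-th member of a flag. -/
def layer (c : MaxFlagA F n) (j : Fin (n + 1)) : Set (Fin (n + 1) → F) :=
  (c.1 j.succ : Set (Fin (n + 1) → F)) \ c.1 j.castSucc

theorem mem_layer {c : MaxFlagA F n} {j : Fin (n + 1)} {x : Fin (n + 1) → F} :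
    x ∈ c.layer j ↔ x ∈ c.1 j.succ ∧ x ∉ c.1 j.castSucc :=
  Iff.rfl

theorem natCard_layer [Fintype F] (c : MaxFlagA F n) (j : Fin (n + 1)) :
    Nat.card (c.layer j) = Fintype.card F ^ ((j : ℕ) + 1) - Fintype.card F ^ (j : ℕ) := by
  have hle : (c.1 j.castSucc : Set (Fin (n + 1) → F)) ⊆ c.1 j.succ :=
    c.2.1 (Fin.castSucc_lt_succ).le
  have hcard (k : Fin (n + 2)) :
      (c.1 k : Set (Fin (n + 1) → F)).ncard = Fintype.card F ^ (k : ℕ) := by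
    rw [← Nat.card_coe_set_eq]
    exact (Module.natCard_eq_pow_finrank (K := F) (V := c.1 k)).trans
      (by rw [c.2.2 k, Nat.card_eq_fintype_card])
  rw [Nat.card_coe_set_eq, layer, Set.ncard_sdiff hle, hcard, hcard]
  simp

/-- The member of a flag is spanned by any choice of vectors from the layers below it. -/
theorem eq_span_of_mem_layer {c : MaxFlagA F n} {v : Fin (n + 1) → Fin (n + 1) → F}
    (hv : ∀ j, v j ∈ c.layer j) (k : Fin (n + 2)) :
    c.1 k = Submodule.span F (v '' {j | (j : ℕ) < k}) := by
  induction k using Fin.induction with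
  | zero =>
    have h := c.2.2 0
    simp only [Fin.val_zero, Submodule.finrank_eq_zero] at h
    simp [h]
  | succ k ih =>
    have hset : {j : Fin (n + 1) | (j : ℕ) < k.succ} =
        insert k {j : Fin (n + 1) | (j : ℕ) < k.castSucc} := by
      ext j
      simp only [Set.mem_ofPred_eq, Set.mem_insert_iff, Fin.val_succ, Fin.val_castSucc, Fin.ext_iff]
      omega
    obtain ⟨h1, h2⟩ := mem_layer.1 (hv k)
    rw [hset, Set.image_insert_eq, Submodule.span_insert, ← ih]
    have hlt : c.1 k.castSucc < Submodule.span F {v k} ⊔ c.1 k.castSucc := by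
      refine lt_of_le_of_ne le_sup_right fun h => h2 ?_
      rw [h]
      exact Submodule.mem_sup_left (Submodule.mem_span_singleton_self _)
    have hle : Submodule.span F {v k} ⊔ c.1 k.castSucc ≤ c.1 k.succ :=
      sup_le ((Submodule.span_singleton_le_iff_mem _ _).2 h1) (c.2.1 (Fin.castSucc_lt_succ).le)
    refine (Submodule.eq_of_le_of_finrank_le hle ?_).symm
    have := Submodule.finrank_lt_finrank_of_lt hlt
    rw [c.2.2] at this ⊢
    simpa using this

theorem linearIndependent_of_mem_layer {c : MaxFlagA F n} {v : Fin (n + 1) → Fin (n + 1) → F}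
    (hv : ∀ j, v j ∈ c.layer j) : LinearIndependent F v := by
  apply linearIndependent_of_top_le_span_of_card_eq_finrank
  · have hset : {j : Fin (n + 1) | (j : ℕ) < Fin.last (n + 1)} = Set.univ := by
      ext j
      simpa using Nat.lt_succ_iff.1 j.2
    have h := eq_span_of_mem_layer hv (Fin.last (n + 1))
    rw [hset, Set.image_univ] at h
    rw [← h, Submodule.eq_top_of_finrank_eq (S := c.1 (Fin.last (n + 1))) (by simp [c.2.2])]
  · simp

/-- The flag spanned by the initial segments of a basis. -/
def ofLinearIndependent {v : Fin (n + 1) → Fin (n + 1) → F} (hv : LinearIndependent F v) :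
    MaxFlagA F n :=
  ⟨fun k => Submodule.span F (v '' {j | (j : ℕ) < k}),
    fun _ _ hkl => Submodule.span_mono (Set.image_mono fun j (hj : (j : ℕ) < _) =>
      show (j : ℕ) < _ from hj.trans_le hkl),
    fun k => by
      beta_reduce
      rw [← Subtype.range_coe (s := {j : Fin (n + 1) | (j : ℕ) < k}), ← Set.range_comp,
        finrank_span_eq_card (hv.comp _ Subtype.val_injective), Fintype.card_subtype]
      have := k.2
      simp only [Set.mem_ofPred_eq, Fin.card_filter_val_lt]
      omega⟩

theorem mem_layer_ofLinearIndependent {v : Fin (n + 1) → Fin (n + 1) → F}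
    (hv : LinearIndependent F v) (j : Fin (n + 1)) : v j ∈ (ofLinearIndependent hv).layer j :=
  mem_layer.2 ⟨Submodule.subset_span (Set.mem_image_of_mem v (by simp)),
    hv.notMem_span_image (s := {i | (i : ℕ) < j.castSucc}) (by simp)⟩

/-- Choosing a vector in every layer of a flag is the same as choosing an ordered basis. -/
noncomputable def sigmaLayerEquiv :
    (Σ c : MaxFlagA F n, ∀ j, c.layer j) ≃
      {v : Fin (n + 1) → Fin (n + 1) → F // LinearIndependent F v} :=
  Equiv.ofBijective
    (fun p => ⟨fun j => p.2 j, linearIndependent_of_mem_layer fun j => (p.2 j).2⟩) <| by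
      constructor
      · rintro ⟨c, w⟩ ⟨d, z⟩ h
        have h' : (fun j => (w j : Fin (n + 1) → F)) = fun j => (z j : Fin (n + 1) → F) :=
          congrArg Subtype.val h
        have hcd : c = d := by
          refine Subtype.ext (funext fun k => ?_)
          rw [eq_span_of_mem_layer (fun j => (w j).2) k, h',
            eq_span_of_mem_layer (fun j => (z j).2) k]
        subst hcd
        have hwz : w = z := funext fun j => Subtype.ext (congrFun h' j)
        rw [hwz]
      · rintro ⟨v, hv⟩
        exact ⟨⟨ofLinearIndependent hv, fun j => ⟨v j, mem_layer_ofLinearIndependent hv j⟩⟩, rfl⟩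

theorem natCard_mul_prod [Fintype F] :
    Nat.card (MaxFlagA F n) *
        ∏ j : Fin (n + 1), (Fintype.card F ^ ((j : ℕ) + 1) - Fintype.card F ^ (j : ℕ)) =
      ∏ j : Fin (n + 1), (Fintype.card F ^ (n + 1) - Fintype.card F ^ (j : ℕ)) := by
  have := Fintype.ofFinite (MaxFlagA F n)
  have h := card_linearIndependent (K := F) (V := Fin (n + 1) → F) (k := n + 1) (by simp)
  rw [← Nat.card_congr sigmaLayerEquiv, Nat.card_sigma] at h
  simp only [Nat.card_pi, natCard_layer, Finset.sum_const, Finset.card_univ, smul_eq_mul] at h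
  simpa using h

/-- A linear automorphism acts on flags. -/
def map (g : (Fin (n + 1) → F) ≃ₗ[F] (Fin (n + 1) → F)) (c : MaxFlagA F n) : MaxFlagA F n :=
  ⟨fun k => (c.1 k).map g.toLinearMap, fun _ _ hkl => Submodule.map_mono (c.2.1 hkl),
    fun k => (LinearEquiv.finrank_map_eq g _).trans (c.2.2 k)⟩

theorem map_mem_layer_map (g : (Fin (n + 1) → F) ≃ₗ[F] (Fin (n + 1) → F)) {c : MaxFlagA F n}
    {j : Fin (n + 1)} {x : Fin (n + 1) → F} (hx : x ∈ c.layer j) : g x ∈ (c.map g).layer j := by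
  refine ⟨Submodule.mem_map_of_mem hx.1, ?_⟩
  rintro ⟨y, hy, hyx⟩
  exact hx.2 (g.injective hyx ▸ hy)

theorem map_injective (g : (Fin (n + 1) → F) ≃ₗ[F] (Fin (n + 1) → F)) :
    Function.Injective (map g) := fun _ _ h =>
  Subtype.ext <| funext fun k => Submodule.map_injective_of_injective g.injective
    (congrFun (congrArg Subtype.val h) k)

theorem natCard_mem_layer_le [Finite F] (j : Fin (n + 1)) {x y : Fin (n + 1) → F}
    (hx : x ≠ 0) (hy : y ≠ 0) :
    Nat.card {c : MaxFlagA F n // x ∈ c.layer j} ≤ Nat.card {c : MaxFlagA F n // y ∈ c.layer j} := by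
  obtain ⟨g, rfl⟩ := exists_linearEquiv_map_eq_of_ne_zero (K := F) hx hy
  exact Nat.card_le_card_of_injective
    (Subtype.map (map g) fun _ hc => map_mem_layer_map g hc) (Subtype.map_injective _ (map_injective g))

theorem ne_zero_of_mem_layer {c : MaxFlagA F n} {j : Fin (n + 1)} {x : Fin (n + 1) → F}
    (hx : x ∈ c.layer j) : x ≠ 0 := by
  rintro rfl
  exact hx.2 (zero_mem _)

/-- Counting the pairs of a flag and a vector in its `j`-th layer in two ways. -/
theorem natCard_mem_layer_mul [Fintype F] (j : Fin (n + 1)) {x : Fin (n + 1) → F} (hx : x ≠ 0) :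
    (Fintype.card F ^ (n + 1) - 1) * Nat.card {c : MaxFlagA F n // x ∈ c.layer j} =
      Nat.card (MaxFlagA F n) *
        (Fintype.card F ^ ((j : ℕ) + 1) - Fintype.card F ^ (j : ℕ)) := by
  classical
  have := Fintype.ofFinite (MaxFlagA F n)
  let e : (Σ c : MaxFlagA F n, c.layer j) ≃
      Σ y : {y : Fin (n + 1) → F // y ≠ 0}, {c : MaxFlagA F n // y.1 ∈ c.layer j} :=
    { toFun p := ⟨⟨p.2, ne_zero_of_mem_layer p.2.2⟩, ⟨p.1, p.2.2⟩⟩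
      invFun p := ⟨p.2.1, ⟨p.1.1, p.2.2⟩⟩ }
  have h := Nat.card_congr e
  rw [Nat.card_sigma, Nat.card_sigma] at h
  have hconst (y : {y : Fin (n + 1) → F // y ≠ 0}) :
      Nat.card {c : MaxFlagA F n // y.1 ∈ c.layer j} =
        Nat.card {c : MaxFlagA F n // x ∈ c.layer j} :=
    le_antisymm (natCard_mem_layer_le j y.2 hx) (natCard_mem_layer_le j hx y.2)
  simp only [hconst, natCard_layer, Finset.sum_const, Finset.card_univ, smul_eq_mul] at h
  rw [← Nat.card_eq_fintype_card (α := MaxFlagA F n)] at h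
  rw [h]
  simp [Fintype.card_subtype_compl]

theorem flagTypeA_span_singleton_eq_iff (c : MaxFlagA F n) (x : Fin (n + 1) → F)
    (j : Fin (n + 1)) :
    flagTypeA c (Submodule.span F {x}) = j + 1 ↔ x ∈ c.layer j := by
  have hset (k : Fin (n + 2)) :
      (k : ℕ) ∈ {k : ℕ | Submodule.span F {x} ≤ flagMemA c k} ↔ x ∈ c.1 k := by
    simp [flagMemA, Submodule.span_singleton_le_iff_mem]
  have hmem := hset j.succ
  have hnot := hset j.castSucc
  rw [Fin.val_succ] at hmem
  rw [Fin.val_castSucc] at hnot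
  rw [mem_layer, ← hmem, ← hnot]
  refine Nat.sInf_upward_closed_eq_succ_iff ?_ _
  intro k l hkl hk
  simp only [Set.mem_ofPred_eq] at hk ⊢
  refine hk.trans ?_
  unfold flagMemA
  split_ifs with h1 h2
  · exact c.2.1 hkl
  · exact le_top
  · omega
  · exact le_top

end MaxFlagA

/-- `|C_i^X| = q^(i-1) * ∏_{k=1}^{n-1} (q^(k+1)-1)/(q-1)`. -/
theorem card_type_i_flags (F : Type) [Field F] [Fintype F] (q : ℕ) (hq : Fintype.card F = q)
    (n : ℕ) (X : Submodule F (Fin (n + 1) → F)) (hX : Module.finrank F X = 1)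
    (i : ℕ) (hi1 : 1 ≤ i) (hi2 : i ≤ n + 1) :
    (Nat.card {c : MaxFlagA F n // flagTypeA c X = i} : ℚ) =
      (q : ℚ) ^ (i - 1) *
        ∏ k ∈ Finset.Icc 1 (n - 1), ((q : ℚ) ^ (k + 1) - 1) / ((q : ℚ) - 1) := by
  obtain ⟨x, hx, rfl⟩ : ∃ x : Fin (n + 1) → F, x ≠ 0 ∧ Submodule.span F {x} = X := by
    obtain ⟨x, hx, h⟩ := finrank_eq_one_iff'.1 hX
    refine ⟨x, by simpa using hx, le_antisymm
      ((Submodule.span_singleton_le_iff_mem _ _).2 x.2) fun y hy => ?_⟩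
    obtain ⟨a, ha⟩ := h ⟨y, hy⟩
    exact Submodule.mem_span_singleton.2 ⟨a, congrArg Subtype.val ha⟩
  obtain ⟨j, rfl⟩ : ∃ j : Fin (n + 1), i = j + 1 := ⟨⟨i - 1, by omega⟩, by simp; omega⟩
  simp only [MaxFlagA.flagTypeA_span_singleton_eq_iff]
  have hq1 : 1 < q := hq ▸ Fintype.one_lt_card
  have hcount := MaxFlagA.natCard_mem_layer_mul j hx
  have htotal := MaxFlagA.natCard_mul_prod (F := F) (n := n)
  rw [hq] at hcount htotal
  have hpow {a b : ℕ} (hab : a ≤ b) : q ^ a ≤ q ^ b := Nat.pow_le_pow_right (by omega) hab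
  generalize Nat.card {c : MaxFlagA F n // x ∈ c.layer j} = A at hcount ⊢
  generalize Nat.card (MaxFlagA F n) = N at hcount htotal
  have hqQ : (1 : ℚ) < q := by exact_mod_cast hq1
  have hcount' : ((q : ℚ) ^ (n + 1) - 1) * A = N * (q ^ (j : ℕ) * (q - 1)) := by
    have h := congrArg (Nat.cast (R := ℚ)) hcount
    rw [Nat.cast_mul, Nat.cast_mul, Nat.cast_sub (Nat.one_le_pow _ _ (by omega)),
      Nat.cast_sub (hpow (by omega))] at h
    push_cast at h
    rw [h]
    ring
  have htotal' : (N : ℚ) * ∏ j ∈ Finset.range (n + 1), ((q : ℚ) ^ j * (q - 1)) =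
      ∏ j ∈ Finset.range (n + 1), ((q : ℚ) ^ j * (q ^ (n + 1 - j) - 1)) := by
    have h := congrArg (Nat.cast (R := ℚ)) htotal
    rw [Fin.prod_univ_eq_prod_range (fun j => q ^ (j + 1) - q ^ j),
      Fin.prod_univ_eq_prod_range (fun j => q ^ (n + 1) - q ^ j)] at h
    push_cast at h
    refine (congrArg (_ * ·) ?_).trans (h.trans ?_)
    · refine Finset.prod_congr rfl fun k _ => ?_
      rw [Nat.cast_sub (hpow (by omega))]
      push_cast
      ring
    · refine Finset.prod_congr rfl fun k hk => ?_
      have hk' : k ≤ n + 1 := (Finset.mem_range.1 hk).le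
      rw [Nat.cast_sub (hpow hk'), mul_sub, ← pow_add, Nat.add_sub_cancel' hk', mul_one]
      push_cast
      rfl
  have hN : (N : ℚ) = ∏ k ∈ Finset.range (n + 1), ((q : ℚ) ^ (k + 1) - 1) / (q - 1) := by
    have hne : ∏ j ∈ Finset.range (n + 1), ((q : ℚ) ^ j * (q - 1)) ≠ 0 :=
      Finset.prod_ne_zero_iff.2 fun k _ => mul_ne_zero (by positivity) (by linarith)
    have hreflect : ∏ j ∈ Finset.range (n + 1), ((q : ℚ) ^ (n + 1 - j) - 1) =
        ∏ k ∈ Finset.range (n + 1), ((q : ℚ) ^ (k + 1) - 1) := by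
      rw [← Finset.prod_range_reflect]
      refine Finset.prod_congr rfl fun k hk => ?_
      have hk' := Finset.mem_range.1 hk
      rw [show n + 1 - (n + 1 - 1 - k) = k + 1 by omega]
    rw [← mul_left_inj' hne, htotal', Finset.prod_mul_distrib, hreflect,
      ← Finset.prod_mul_distrib, ← Finset.prod_mul_distrib]
    refine Finset.prod_congr rfl fun k _ => ?_
    have : (q : ℚ) - 1 ≠ 0 := by linarith
    field_simp
  have hprod : ∏ k ∈ Finset.Icc 1 (n - 1), ((q : ℚ) ^ (k + 1) - 1) / ((q : ℚ) - 1) =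
      ∏ k ∈ Finset.range n, ((q : ℚ) ^ (k + 1) - 1) / ((q : ℚ) - 1) := by
    refine Finset.prod_subset (M := ℚ) (fun k hk => ?_) fun k hk hk' => ?_
    · simp only [Finset.mem_Icc, Finset.mem_range] at hk ⊢
      omega
    · simp only [Finset.mem_Icc, Finset.mem_range] at hk hk'
      obtain rfl : k = 0 := by omega
      rw [zero_add, pow_one, div_self (by linarith)]
  have hne : (q : ℚ) ^ (n + 1) - 1 ≠ 0 := by
    exact (sub_pos.2 (one_lt_pow₀ hqQ (Nat.succ_ne_zero n))).ne'
  rw [hprod, Nat.add_sub_cancel, ← mul_right_inj' hne, hcount', hN, Finset.prod_range_succ]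
  have : (q : ℚ) - 1 ≠ 0 := by linarith
  field_simp
end

section
/- For every prime power q and every n ≥ 1, the adjacency matrix of the opposition graph on the maximal flags of F_q^{n+1} has smallest eigenvalue −q^{(n²−1)/2} (as a real number), and the eigenspace of this eigenvalue has dimension ⌈n/2⌉·(q^{n+1}−q)/(q−1). -/
instance (F : Type) [Field F] [Fintype F] (n : ℕ) : Finite (MaxFlagA F n) :=
  Subtype.finite

noncomputable instance (F : Type) [Field F] [Fintype F] (n : ℕ) : Fintype (MaxFlagA F n) :=
  Fintype.ofFinite _

def OppA {F : Type} [Field F] {n : ℕ} (c d : MaxFlagA F n) : Prop :=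
  ∀ i : Fin (n + 2), c.1 i ⊓ d.1 i.rev = ⊥

open Classical in
/-- The adjacency matrix of the opposition graph on maximal flags of `F^(n+1)`. -/
noncomputable def adjA (F : Type) [Field F] [Fintype F] (n : ℕ) :
    Matrix (MaxFlagA F n) (MaxFlagA F n) ℝ :=
  fun c d => if OppA c d then 1 else 0

namespace MaxFlagA

variable {F : Type} [Field F] {n : ℕ}

/-- The member of dimension `min k (n + 1)` of a maximal flag. -/
def sub (x : MaxFlagA F n) (k : ℕ) : Submodule F (Fin (n + 1) → F) :=
  x.1 ⟨min k (n + 1), by omega⟩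

theorem finrank_sub (x : MaxFlagA F n) (k : ℕ) : Module.finrank F (x.sub k) = min k (n + 1) :=
  x.2.2 _

theorem sub_mono (x : MaxFlagA F n) : Monotone x.sub := fun i j h =>
  x.2.1 (by rw [Fin.mk_le_mk]; omega)

theorem sub_zero (x : MaxFlagA F n) : x.sub 0 = ⊥ := by
  rw [← Submodule.finrank_eq_zero (R := F), finrank_sub]; simp

theorem sub_of_le (x : MaxFlagA F n) {k : ℕ} (h : n + 1 ≤ k) : x.sub k = ⊤ := by
  apply Submodule.eq_top_of_finrank_eq
  rw [finrank_sub]; simp [h]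

theorem sub_val (x : MaxFlagA F n) (k : Fin (n + 2)) : x.sub k = x.1 k :=
  congrArg x.1 (Fin.ext (min_eq_left (by omega)))

@[ext]
theorem ext {x y : MaxFlagA F n} (h : ∀ k, x.sub k = y.sub k) : x = y := by
  apply Subtype.ext
  funext k
  rw [← sub_val, ← sub_val, h]

theorem exists_of_chain (U : ℕ → Submodule F (Fin (n + 1) → F))
    (hU : ∀ k ≤ n, U k ≤ U (k + 1)) (hd : ∀ k ≤ n + 1, Module.finrank F (U k) = k) :
    ∃ x : MaxFlagA F n, ∀ k ≤ n + 1, x.sub k = U k := by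
  refine ⟨⟨fun k => U k, ?_, fun k => hd k (by omega)⟩, fun k hk => ?_⟩
  · refine Fin.monotone_iff_le_succ.2 fun i => ?_
    exact hU i (by omega)
  · simp [sub, hk]

/-- Two flags that differ at most in dimension `i`. -/
def SamePanel (i : ℕ) (x y : MaxFlagA F n) : Prop :=
  ∀ j, j ≠ i → x.sub j = y.sub j

theorem SamePanel.refl (i : ℕ) (x : MaxFlagA F n) : SamePanel i x x := fun _ _ => rfl

theorem SamePanel.symm {i : ℕ} {x y : MaxFlagA F n} (h : SamePanel i x y) : SamePanel i y x :=
  fun j hj => (h j hj).symm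

theorem SamePanel.trans {i : ℕ} {x y z : MaxFlagA F n} (h : SamePanel i x y)
    (h' : SamePanel i y z) : SamePanel i x z :=
  fun j hj => (h j hj).trans (h' j hj)

theorem SamePanel.eq {i : ℕ} {x y : MaxFlagA F n} (h : SamePanel i x y)
    (h' : x.sub i = y.sub i) : x = y := by
  ext1 k
  by_cases hk : k = i
  · rw [hk, h']
  · exact h k hk

theorem exists_samePanel (x : MaxFlagA F n) {i : ℕ} (hi : i < n)
    {W : Submodule F (Fin (n + 1) → F)} (h₁ : x.sub i ≤ W) (h₂ : W ≤ x.sub (i + 2))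
    (hW : Module.finrank F W = i + 1) : ∃ y, SamePanel (i + 1) x y ∧ y.sub (i + 1) = W := by
  obtain ⟨y, hy⟩ := exists_of_chain (n := n) (fun j => if j = i + 1 then W else x.sub j)
    (fun k hk => by
      by_cases h : k = i + 1
      · subst h; simpa using h₂
      · by_cases h' : k = i
        · subst h'; simpa using h₁
        · simpa [h, h'] using x.sub_mono (Nat.le_succ k))
    (fun k hk => by
      by_cases h : k = i + 1
      · rw [if_pos h, hW, h]
      · rw [if_neg h, finrank_sub, min_eq_left hk])
  refine ⟨y, fun j hj => ?_, ?_⟩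
  · by_cases hj' : j ≤ n + 1
    · rw [hy j hj', if_neg hj]
    · rw [sub_of_le _ (by omega), sub_of_le _ (by omega)]
  · rw [hy _ (by omega), if_pos rfl]

/-- A line in `x.sub (i + 2)` off `x.sub i` picks out one member of a panel. -/
theorem existsUnique_samePanel_mem (x : MaxFlagA F n) {i : ℕ} (hi : i < n) {v : Fin (n + 1) → F}
    (hv : v ∉ x.sub i) (hv' : v ∈ x.sub (i + 2)) :
    ∃! y, SamePanel (i + 1) x y ∧ v ∈ y.sub (i + 1) := by
  have hd : Module.finrank F (x.sub i ⊔ Submodule.span F {v} : Submodule F _) = i + 1 := by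
    rw [Submodule.finrank_sup_span_singleton hv, finrank_sub]; omega
  have hle : Submodule.span F {v} ≤ x.sub (i + 2) := by simpa using hv'
  obtain ⟨y, hy, hy'⟩ := x.exists_samePanel hi (le_sup_left (b := Submodule.span F {v}))
    (sup_le (x.sub_mono (by omega)) hle) hd
  refine ⟨y, ⟨hy, ?_⟩, fun z hz => ?_⟩
  · rw [hy']
    exact Submodule.mem_sup_right (Submodule.mem_span_singleton_self v)
  · refine (hz.1.symm.trans hy).eq ?_
    symm
    rw [hy']
    apply Submodule.eq_of_le_of_finrank_eq
    · refine sup_le ?_ (by simpa using hz.2)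
      rw [hz.1 i (by omega)]
      exact z.sub_mono (by omega)
    · rw [hd, finrank_sub]; omega

theorem mem_sub_add_two_of_samePanel {x y : MaxFlagA F n} {i : ℕ} (h : SamePanel (i + 1) x y)
    {v : Fin (n + 1) → F} (hv : v ∈ y.sub (i + 1)) : v ∈ x.sub (i + 2) := by
  rw [h (i + 2) (by omega)]
  exact y.sub_mono (by omega) hv

open Classical in
theorem card_samePanel [Fintype F] (x : MaxFlagA F n) {i : ℕ} (hi : i < n) :
    (Finset.univ.filter (SamePanel (i + 1) x)).card = Fintype.card F + 1 := by
  have hq : 1 < Fintype.card F := Fintype.one_lt_card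
  have hcard : ∀ (U W : Submodule F (Fin (n + 1) → F)), U ≤ W →
      (Finset.univ.filter fun v => v ∈ W ∧ v ∉ U).card + Fintype.card F ^ Module.finrank F U =
        Fintype.card F ^ Module.finrank F W := by
    intro U W h
    have h1 : ∀ S : Submodule F (Fin (n + 1) → F),
        Fintype.card F ^ Module.finrank F S = (Finset.univ.filter fun v => v ∈ S).card := by
      intro S
      rw [← Module.card_eq_pow_finrank (K := F) (V := S), Fintype.card_subtype]
    rw [h1, h1, ← Finset.card_union_of_disjoint]
    · congr 1
      ext v
      simp only [Finset.mem_union, Finset.mem_filter, Finset.mem_univ, true_and]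
      have := @h v
      tauto
    · rw [Finset.disjoint_filter]
      tauto
  have key : ∑ y ∈ Finset.univ.filter (SamePanel (i + 1) x),
      (Finset.univ.filter fun v => v ∈ y.sub (i + 1) ∧ v ∉ x.sub i).card =
      (Finset.univ.filter fun v => v ∈ x.sub (i + 2) ∧ v ∉ x.sub i).card := by
    rw [← Finset.card_biUnion]
    · congr 1
      ext v
      simp only [Finset.mem_biUnion, Finset.mem_filter, Finset.mem_univ, true_and]
      constructor
      · rintro ⟨y, h, hv, hv'⟩
        exact ⟨mem_sub_add_two_of_samePanel h hv, hv'⟩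
      · rintro ⟨hv, hv'⟩
        obtain ⟨y, ⟨h1, h2⟩, -⟩ := x.existsUnique_samePanel_mem hi hv' hv
        exact ⟨y, h1, h2, hv'⟩
    · intro y hy z hz hne
      simp only [Finset.coe_filter, Finset.mem_univ, true_and, Set.mem_ofPred_eq] at hy hz
      refine Finset.disjoint_filter.2 ?_
      rintro v - ⟨hv, hv'⟩ ⟨hw, -⟩
      exact hne ((x.existsUnique_samePanel_mem hi hv' (mem_sub_add_two_of_samePanel hy hv)).unique
        ⟨hy, hv⟩ ⟨hz, hw⟩)
  have h2 := hcard (x.sub i) (x.sub (i + 2)) (x.sub_mono (by omega))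
  rw [Finset.sum_congr rfl (g := fun _ => Fintype.card F ^ (i + 1) - Fintype.card F ^ i)] at key
  · rw [Finset.sum_const, smul_eq_mul] at key
    rw [← key, finrank_sub, finrank_sub, min_eq_left (by omega), min_eq_left (by omega)] at h2
    set q := Fintype.card F
    set N := (Finset.univ.filter (SamePanel (i + 1) x)).card
    have h3 : q ^ (i + 1) - q ^ i = (q - 1) * q ^ i := by
      rw [Nat.sub_mul, pow_succ']; simp
    rw [h3] at h2
    have h4 : q ^ i * (N * (q - 1) + 1) = q ^ i * ((q + 1) * (q - 1) + 1) := by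
      obtain ⟨r, hr⟩ : ∃ r, q = r + 1 := ⟨q - 1, by omega⟩
      rw [hr] at h2 ⊢
      simp only [Nat.add_sub_cancel] at h2 ⊢
      calc _ = N * (r * (r + 1) ^ i) + (r + 1) ^ i := by ring
        _ = (r + 1) ^ (i + 2) := h2
        _ = _ := by ring
    have h5 := Nat.eq_of_mul_eq_mul_left (by positivity) h4
    exact Nat.eq_of_mul_eq_mul_right (by omega : 0 < q - 1) (by omega)
  · intro y hy
    simp only [Finset.mem_filter, Finset.mem_univ, true_and] at hy
    have h := hcard (y.sub i) (y.sub (i + 1)) (y.sub_mono (by omega))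
    rw [finrank_sub, finrank_sub, min_eq_left (by omega), min_eq_left (by omega)] at h
    rw [hy i (by omega)]
    omega

/-- Two flags joined by a gallery that only uses panels of types above `j`. -/
def Linked (j : ℕ) (x y : MaxFlagA F n) : Prop :=
  Relation.ReflTransGen (fun a b => ∃ i, j < i ∧ i ≤ n ∧ SamePanel i a b) x y

theorem Linked.sub_eq {j : ℕ} {x y : MaxFlagA F n} (h : Linked j x y) {k : ℕ} (hk : k ≤ j) :
    x.sub k = y.sub k := by
  induction h with
  | refl => rfl
  | tail _ h ih =>
    obtain ⟨i, hi, -, h⟩ := h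
    rw [ih, h k (by omega)]

theorem Linked.symm {j : ℕ} {x y : MaxFlagA F n} (h : Linked j x y) : Linked j y x := by
  induction h with
  | refl => exact Relation.ReflTransGen.refl
  | tail _ h ih =>
    obtain ⟨i, hi, hi', h⟩ := h
    exact Relation.ReflTransGen.head ⟨i, hi, hi', h.symm⟩ ih

theorem Linked.trans {j : ℕ} {x y z : MaxFlagA F n} (h : Linked j x y) (h' : Linked j y z) :
    Linked j x z :=
  Relation.ReflTransGen.trans h h'

theorem Linked.mono {j k : ℕ} (hjk : k ≤ j) {x y : MaxFlagA F n} (h : Linked j x y) :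
    Linked k x y :=
  Relation.ReflTransGen.mono (fun _ _ ⟨i, hi, h⟩ => ⟨i, by omega, h⟩) _ _ h

theorem exists_linked_mem (x : MaxFlagA F n) (j : ℕ) (v : Fin (n + 1) → F) :
    ∃ y, Linked j x y ∧ v ∈ y.sub (j + 1) := by
  have key : ∀ (k : ℕ) (x : MaxFlagA F n), v ∈ x.sub (j + 1 + k) →
      ∃ y, Linked j x y ∧ v ∈ y.sub (j + 1) := by
    intro k
    induction k with
    | zero => exact fun x hx => ⟨x, Relation.ReflTransGen.refl, hx⟩
    | succ k ih =>
      intro x hx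
      by_cases hv : v ∈ x.sub (j + 1 + k)
      · exact ih x hv
      · have hn : j + k < n := by
          by_contra h
          exact hv (by rw [x.sub_of_le (by omega)]; trivial)
        have e : j + 1 + k = j + k + 1 := by omega
        obtain ⟨y, ⟨hy, hvy⟩, -⟩ := x.existsUnique_samePanel_mem hn
          (fun h => hv (x.sub_mono (by omega) h))
          (by rwa [show j + k + 2 = j + 1 + (k + 1) by omega])
        obtain ⟨z, hz, hvz⟩ := ih y (by rwa [e])
        exact ⟨z, Relation.ReflTransGen.head ⟨j + k + 1, by omega, by omega, hy⟩ hz, hvz⟩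
  exact key n x (by rw [x.sub_of_le (by omega)]; trivial)

theorem exists_mem_notMem (x : MaxFlagA F n) {k : ℕ} (hk : k ≤ n) :
    ∃ v ∈ x.sub (k + 1), v ∉ x.sub k := by
  apply SetLike.exists_of_lt
  refine lt_of_le_of_ne (x.sub_mono (by omega)) fun h => ?_
  have := congrArg (fun W : Submodule F _ => Module.finrank F W) h
  simp only [finrank_sub] at this
  omega

theorem linked_of_sub_eq {x y : MaxFlagA F n} {k : ℕ} (h : ∀ j ≤ k, x.sub j = y.sub j) :
    Linked k x y := by
  induction hm : n + 1 - k generalizing k y with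
  | zero =>
    have : x = y := by
      ext1 j
      by_cases hj : j ≤ k
      · exact h j hj
      · rw [sub_of_le _ (by omega), sub_of_le _ (by omega)]
    exact this ▸ Relation.ReflTransGen.refl
  | succ m ih =>
    obtain ⟨v, hv, hv'⟩ := x.exists_mem_notMem (k := k) (by omega)
    obtain ⟨z, hz, hvz⟩ := y.exists_linked_mem k v
    have hxz : ∀ j ≤ k, x.sub j = z.sub j := fun j hj => (h j hj).trans (hz.sub_eq hj)
    have hd : Module.finrank F (x.sub k ⊔ Submodule.span F {v} : Submodule F _) = k + 1 := by
      rw [Submodule.finrank_sup_span_singleton hv', finrank_sub]; omega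
    have h1 : x.sub k ⊔ Submodule.span F {v} = x.sub (k + 1) := by
      apply Submodule.eq_of_le_of_finrank_eq
      · exact sup_le (x.sub_mono (by omega)) (by simpa using hv)
      · rw [hd, finrank_sub]; omega
    have h2 : x.sub k ⊔ Submodule.span F {v} = z.sub (k + 1) := by
      apply Submodule.eq_of_le_of_finrank_eq
      · rw [hxz k le_rfl]
        exact sup_le (z.sub_mono (by omega)) (by simpa using hvz)
      · rw [hd, finrank_sub]; omega
    refine (Linked.mono (Nat.le_succ k) (ih (k := k + 1) (y := z) ?_ (by omega))).trans hz.symm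
    intro j hj
    rcases Nat.lt_or_ge k j with h' | h'
    · rw [show j = k + 1 by omega, ← h1, h2]
    · exact hxz j h'

end MaxFlagA

section RelOp

variable {X : Type*} [Fintype X]

open Classical in
/-- The operator on real functions whose matrix is the indicator of the relation `r`. -/
noncomputable def relOp (r : X → X → Prop) : Module.End ℝ (X → ℝ) where
  toFun v x := ∑ y with r x y, v y
  map_add' v w := by ext x; simp [Finset.sum_add_distrib]
  map_smul' c v := by ext x; simp [Finset.mul_sum]

open Classical in
theorem relOp_apply (r : X → X → Prop) (v : X → ℝ) (x : X) :
    relOp r v x = ∑ y with r x y, v y := rfl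

theorem relOp_congr {r s : X → X → Prop} (h : ∀ x y, r x y ↔ s x y) : relOp r = relOp s := by
  congr 1
  ext x y
  exact h x y

open Classical in
theorem relOp_mul_apply (r s : X → X → Prop) (v : X → ℝ) (x : X) :
    (relOp r * relOp s) v x =
      ∑ z, ((Finset.univ.filter fun y => r x y ∧ s y z).card : ℝ) * v z := by
  simp only [Module.End.mul_apply, relOp_apply, Finset.sum_filter]
  have : ∀ y, (if r x y then ∑ z, (if s y z then v z else 0) else 0) =
      ∑ z, if r x y ∧ s y z then v z else 0 := by
    intro y
    by_cases h : r x y <;> simp [h]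
  simp only [this]
  rw [Finset.sum_comm]
  refine Finset.sum_congr rfl fun z _ => ?_
  rw [← Finset.sum_filter, Finset.sum_const, nsmul_eq_mul]

open Classical in
theorem relOp_mul_congr {r s r' s' : X → X → Prop}
    (h : ∀ x z, (Finset.univ.filter fun y => r x y ∧ s y z).card =
      (Finset.univ.filter fun y => r' x y ∧ s' y z).card) :
    relOp r * relOp s = relOp r' * relOp s' := by
  refine LinearMap.ext fun v => ?_
  funext x
  simp only [relOp_mul_apply, h]

theorem relOp_mul_eq {r s t : X → X → Prop} (h : ∀ x z, t x z → ∃! y, r x y ∧ s y z)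
    (h' : ∀ x y z, r x y → s y z → t x z) : relOp r * relOp s = relOp t := by
  classical
  refine LinearMap.ext fun v => ?_
  funext x
  rw [relOp_mul_apply, relOp_apply, Finset.sum_filter]
  refine Finset.sum_congr rfl fun z _ => ?_
  by_cases ht : t x z
  · obtain ⟨y, hy, hu⟩ := h x z ht
    have : (Finset.univ.filter fun y => r x y ∧ s y z) = {y} := by
      ext w
      simp only [Finset.mem_filter, Finset.mem_univ, true_and, Finset.mem_singleton]
      exact ⟨hu w, fun hw => hw ▸ hy⟩
    simp [this, ht]
  · have : (Finset.univ.filter fun y => r x y ∧ s y z) = ∅ := by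
      ext w
      simp only [Finset.mem_filter, Finset.mem_univ, true_and, Finset.notMem_empty, iff_false]
      exact fun hw => ht (h' x w z hw.1 hw.2)
    simp [this, ht]

theorem relOp_eq : relOp (fun x y : X => x = y) = 1 := by
  classical
  refine LinearMap.ext fun v => ?_
  funext x
  simp [relOp_apply, Finset.filter_eq]

theorem relOp_dotProduct {r : X → X → Prop} (hr : ∀ x y, r x y → r y x) (v w : X → ℝ) :
    relOp r v ⬝ᵥ w = v ⬝ᵥ relOp r w := by
  classical
  simp only [dotProduct, relOp_apply, Finset.sum_mul, Finset.mul_sum, Finset.sum_filter]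
  rw [Finset.sum_comm]
  refine Finset.sum_congr rfl fun x _ => Finset.sum_congr rfl fun y _ => ?_
  rw [if_congr ⟨hr y x, hr x y⟩ rfl rfl]
  split_ifs <;> simp

end RelOp

namespace MaxFlagA

variable {F : Type} [Field F] {n : ℕ}

/-- The relation of the Coxeter word `s₁ s₂ ⋯ sₖ`. -/
def Sweep (k : ℕ) (x y : MaxFlagA F n) : Prop :=
  (∀ j, k < j → x.sub j = y.sub j) ∧ x.sub 1 ⊓ y.sub k = ⊥ ∧ ∀ j ≤ k, y.sub j ≤ x.sub (j + 1)

/-- The flags agree from dimension `k` on and are opposite below it. -/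
def PartOpp (k : ℕ) (x y : MaxFlagA F n) : Prop :=
  (∀ j, k ≤ j → x.sub j = y.sub j) ∧ ∀ j ≤ k, x.sub j ⊓ y.sub (k - j) = ⊥

theorem oppA_iff {x y : MaxFlagA F n} :
    OppA x y ↔ ∀ j ≤ n + 1, x.sub j ⊓ y.sub (n + 1 - j) = ⊥ := by
  have h : ∀ i : Fin (n + 2), x.sub i ⊓ y.sub (n + 1 - i) = x.1 i ⊓ y.1 i.rev := by
    intro i
    rw [← sub_val, ← sub_val, Fin.val_rev]
    congr 2
    omega
  unfold OppA
  simp only [← h]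
  exact ⟨fun H j hj => H ⟨j, by omega⟩, fun H i => H i (by omega)⟩

theorem partOpp_last_iff {x y : MaxFlagA F n} : PartOpp (n + 1) x y ↔ OppA x y := by
  rw [oppA_iff]
  exact ⟨fun h => h.2, fun h => ⟨fun j hj => by rw [sub_of_le _ hj, sub_of_le _ hj], h⟩⟩

theorem oppA_symm {x y : MaxFlagA F n} (h : OppA x y) : OppA y x := by
  rw [oppA_iff] at *
  intro j hj
  rw [inf_comm]
  have := h (n + 1 - j) (by omega)
  rwa [show n + 1 - (n + 1 - j) = j by omega] at this

theorem eq_of_le {U W : Submodule F (Fin (n + 1) → F)} (h : U ≤ W)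
    (hd : Module.finrank F W ≤ Module.finrank F U) : U = W :=
  Submodule.eq_of_le_of_finrank_le h hd

theorem finrank_sup_of_disjoint {U W : Submodule F (Fin (n + 1) → F)} (h : U ⊓ W = ⊥) :
    Module.finrank F (U ⊔ W : Submodule F _) = Module.finrank F U + Module.finrank F W := by
  rw [← Submodule.finrank_sup_add_finrank_inf_eq, h, finrank_bot, add_zero]

theorem finrank_sub_inf (x : MaxFlagA F n) {H : Submodule F (Fin (n + 1) → F)} {k j : ℕ}
    (hk : k ≤ n) (hH : Module.finrank F H = k) (hle : H ≤ x.sub (k + 1)) (h1 : x.sub 1 ⊓ H = ⊥)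
    (hj : j ≤ k) : Module.finrank F (x.sub (j + 1) ⊓ H : Submodule F _) = j := by
  apply le_antisymm
  · have h : x.sub 1 ⊓ (x.sub (j + 1) ⊓ H) = ⊥ := by
      rw [eq_bot_iff, ← h1]
      exact inf_le_inf_left _ inf_le_right
    have h2 := finrank_sup_of_disjoint h
    have h3 : Module.finrank F (x.sub 1 ⊔ x.sub (j + 1) ⊓ H : Submodule F _) ≤
        Module.finrank F (x.sub (j + 1)) :=
      Submodule.finrank_mono (sup_le (x.sub_mono (by omega)) inf_le_left)
    rw [finrank_sub] at h2 h3
    omega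
  · have h2 := Submodule.finrank_sup_add_finrank_inf_eq (x.sub (j + 1)) H
    have h3 : Module.finrank F (x.sub (j + 1) ⊔ H : Submodule F _) ≤
        Module.finrank F (x.sub (k + 1)) :=
      Submodule.finrank_mono (sup_le (x.sub_mono (by omega)) hle)
    rw [finrank_sub] at h2 h3
    omega

theorem sweep_zero_iff {x y : MaxFlagA F n} : Sweep 0 x y ↔ x = y := by
  constructor
  · intro h
    ext1 k
    rcases Nat.eq_zero_or_pos k with rfl | hk
    · rw [sub_zero, sub_zero]
    · exact h.1 k hk
  · rintro rfl
    refine ⟨fun _ _ => rfl, ?_, fun j hj => x.sub_mono (Nat.le_succ j)⟩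
    rw [sub_zero, inf_bot_eq]

theorem partOpp_zero_iff {x y : MaxFlagA F n} : PartOpp 0 x y ↔ x = y := by
  constructor
  · intro h
    ext1 k
    exact h.1 k (Nat.zero_le k)
  · rintro rfl
    refine ⟨fun _ _ => rfl, fun j hj => ?_⟩
    rw [Nat.le_zero.1 hj, sub_zero, bot_inf_eq]

theorem sub_one_ne_bot (x : MaxFlagA F n) : x.sub 1 ≠ ⊥ := by
  rw [Ne, ← Submodule.finrank_eq_zero (R := F), finrank_sub]
  omega

/-- A submodule avoiding `x.sub 1` is enlarged by one dimension when adding `x.sub 1`. -/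
theorem eq_sup_of_le {x y z : MaxFlagA F n} {k : ℕ} (h : x.sub 1 ⊓ y.sub k = ⊥)
    (h₁ : x.sub 1 ≤ z.sub (k + 1)) (h₂ : y.sub k ≤ z.sub (k + 1)) (hk : k ≤ n) :
    x.sub 1 ⊔ y.sub k = z.sub (k + 1) := by
  refine eq_of_le (sup_le h₁ h₂) ?_
  rw [finrank_sup_of_disjoint h, finrank_sub, finrank_sub, finrank_sub]
  omega

theorem inf_bot_mono {U U' W W' : Submodule F (Fin (n + 1) → F)} (h : U' ⊓ W' = ⊥)
    (hU : U ≤ U') (hW : W ≤ W') : U ⊓ W = ⊥ :=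
  eq_bot_iff.2 (h ▸ inf_le_inf hU hW)

variable [Fintype F]

theorem relOp_sweep_succ {k : ℕ} (hk : k < n) :
    relOp (Sweep (F := F) (n := n) k) * relOp (fun x y => SamePanel (k + 1) x y ∧ x ≠ y) =
      relOp (Sweep (k + 1)) := by
  refine relOp_mul_eq (fun x y h => ?_) fun x z y h h' => ?_
  · obtain ⟨h1, h2, h3⟩ := h
    obtain ⟨z, hz, hz'⟩ := y.exists_samePanel hk (W := x.sub (k + 1)) (h3 k (by omega))
      ((x.sub_mono (by omega)).trans (h1 (k + 2) (by omega)).le)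
      (by rw [finrank_sub]; omega)
    refine ⟨z, ⟨⟨fun j hj => ?_, ?_, fun j hj => ?_⟩, hz.symm, ?_⟩, fun w hw => ?_⟩
    · by_cases hj' : j = k + 1
      · rw [hj', hz']
      · rw [← hz j hj', h1 j (by omega)]
    · rw [← hz k (by omega)]
      exact inf_bot_mono h2 le_rfl (y.sub_mono (by omega))
    · rw [← hz j (by omega)]
      exact h3 j (by omega)
    · rintro rfl
      rw [hz', inf_eq_left.2 (x.sub_mono (by omega))] at h2
      exact x.sub_one_ne_bot h2
    · refine (hw.2.1.trans hz).eq ?_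
      rw [hz', ← hw.1.1 _ (by omega)]
  · obtain ⟨h1, h2, h3⟩ := h
    refine ⟨fun j hj => ?_, ?_, fun j hj => ?_⟩
    · rw [h1 j (by omega), h'.1 j (by omega)]
    · by_contra hne
      apply h'.2
      apply h'.1.eq
      have hle : x.sub 1 ≤ y.sub (k + 1) := by
        have h4 : x.sub 1 ⊓ y.sub (k + 1) = x.sub 1 := by
          refine eq_of_le inf_le_left ?_
          have := mt (Submodule.finrank_eq_zero (R := F)).1 hne
          rw [finrank_sub]
          omega
        exact inf_eq_left.1 h4
      rw [← eq_sup_of_le h2 hle, ← eq_sup_of_le h2]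
      · rw [← h1 (k + 1) (by omega)]
        exact x.sub_mono (by omega)
      · exact z.sub_mono (by omega)
      · omega
      · rw [h'.1 k (by omega)]
        exact y.sub_mono (by omega)
      · omega
    · by_cases hj' : j = k + 1
      · subst hj'
        rw [h1 (k + 1 + 1) (by omega), h'.1 (k + 1 + 1) (by omega)]
        exact y.sub_mono (by omega)
      · rw [← h'.1 j hj']
        exact h3 j (by omega)

theorem relOp_partOpp_succ {k : ℕ} (hk : k ≤ n) :
    relOp (Sweep (F := F) (n := n) k) * relOp (PartOpp k) = relOp (PartOpp (k + 1)) := by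
  refine relOp_mul_eq (fun x y h => ?_) fun x z y h h' => ?_
  · obtain ⟨h1, h2⟩ := h
    have hle : y.sub k ≤ x.sub (k + 1) := by
      rw [h1 _ le_rfl]
      exact y.sub_mono (by omega)
    have h0 : x.sub 1 ⊓ y.sub k = ⊥ := by simpa using h2 1 (by omega)
    have hd : ∀ j ≤ k, Module.finrank F (x.sub (j + 1) ⊓ y.sub k : Submodule F _) = j :=
      fun j hj => x.finrank_sub_inf hk (by rw [finrank_sub]; omega) hle h0 hj
    obtain ⟨z, hz⟩ := exists_of_chain (n := n)
      (fun j => if j ≤ k then x.sub (j + 1) ⊓ y.sub k else x.sub j)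
      (fun j hj => by
        rcases lt_trichotomy j k with h | rfl | h
        · rw [if_pos (by omega), if_pos (by omega)]
          exact inf_le_inf_right _ (x.sub_mono (by omega))
        · rw [if_pos le_rfl, if_neg (by omega)]
          exact inf_le_left
        · rw [if_neg (by omega), if_neg (by omega)]
          exact x.sub_mono (by omega))
      (fun j hj => by
        by_cases h : j ≤ k
        · rw [if_pos h, hd j h]
        · rw [if_neg h, finrank_sub]; omega)
    have hz1 : ∀ j ≤ k, z.sub j = x.sub (j + 1) ⊓ y.sub k := fun j hj => by
      rw [hz j (by omega), if_pos hj]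
    have hz2 : ∀ j, k < j → z.sub j = x.sub j := fun j hj => by
      by_cases hj' : j ≤ n + 1
      · rw [hz j hj', if_neg (by omega)]
      · rw [sub_of_le _ (by omega), sub_of_le _ (by omega)]
    have hzk : z.sub k = y.sub k := by rw [hz1 k le_rfl, inf_eq_right.2 hle]
    refine ⟨z, ⟨⟨fun j hj => (hz2 j hj).symm, by rw [hzk, h0], fun j hj => ?_⟩,
      fun j hj => ?_, fun j hj => ?_⟩, fun w hw => ?_⟩
    · rw [hz1 j hj]
      exact inf_le_left
    · rcases hj.eq_or_lt with rfl | hj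
      · exact hzk
      · rw [hz2 j hj, h1 j hj]
    · rw [hz1 j hj]
      refine inf_bot_mono (h2 (j + 1) (by omega)) inf_le_left ?_
      rw [show k + 1 - (j + 1) = k - j by omega]
    · ext1 j
      by_cases hj : j ≤ k
      · rw [hz1 j hj]
        refine eq_of_le (le_inf (hw.1.2.2 j hj) ?_) ?_
        · rw [← hw.2.1 k le_rfl]
          exact w.sub_mono hj
        · rw [hd j hj, finrank_sub]; omega
      · rw [hz2 j (by omega), hw.1.1 j (by omega)]
  · obtain ⟨h1, h2, h3⟩ := h
    have hzk := h'.1 k le_rfl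
    refine ⟨fun j hj => ?_, fun j hj => ?_⟩
    · rw [h1 j (by omega), h'.1 j (by omega)]
    · rcases j with - | j
      · rw [sub_zero, bot_inf_eq]
      · have hd := x.finrank_sub_inf hk (by rw [finrank_sub]; omega) (h3 k le_rfl) h2
          (show j ≤ k by omega)
        have hz : z.sub j = x.sub (j + 1) ⊓ z.sub k := by
          refine eq_of_le (le_inf (h3 j (by omega)) (z.sub_mono (by omega))) ?_
          rw [hd, finrank_sub]; omega
        rw [eq_bot_iff, ← h'.2 j (by omega), show k + 1 - (j + 1) = k - j by omega]
        refine le_inf ?_ inf_le_right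
        rw [hz, hzk]
        exact inf_le_inf_left _ (y.sub_mono (by omega))

theorem sweep_mul_panel {i : ℕ} (hi : i + 1 < n) :
    relOp (Sweep (F := F) (n := n) n) * relOp (SamePanel (i + 1)) =
      relOp (SamePanel (i + 2)) * relOp (Sweep n) := by
  let t : MaxFlagA F n → MaxFlagA F n → Prop := fun x y =>
    x.sub 1 ⊓ y.sub n = ⊥ ∧ ∀ j ≤ n, j ≠ i + 1 → y.sub j ≤ x.sub (j + 1)
  have htop : ∀ x y : MaxFlagA F n, ∀ j, n < j → x.sub j = y.sub j := fun x y j hj => by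
    rw [sub_of_le _ hj, sub_of_le _ hj]
  have hd : ∀ x y : MaxFlagA F n, x.sub 1 ⊓ y.sub n = ⊥ → ∀ j ≤ n,
      Module.finrank F (x.sub (j + 1) ⊓ y.sub n : Submodule F _) = j := fun x y h j hj =>
    x.finrank_sub_inf le_rfl (by rw [finrank_sub]; omega)
      (by rw [x.sub_of_le le_rfl]; exact le_top) h hj
  trans relOp t
  · refine relOp_mul_eq (fun x y h => ?_) fun x z y h h' => ?_
    · obtain ⟨h1, h2⟩ := h
      have hy : y.sub (i + 2) = x.sub (i + 3) ⊓ y.sub n := by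
        refine eq_of_le (le_inf (h2 _ (by omega) (by omega)) (y.sub_mono (by omega))) ?_
        rw [hd x y h1 _ (by omega), finrank_sub]
        omega
      obtain ⟨z, hz, hz'⟩ := y.exists_samePanel (i := i) (by omega)
        (W := x.sub (i + 2) ⊓ y.sub n)
        (le_inf ((h2 i (by omega) (by omega)).trans (x.sub_mono (by omega)))
          (y.sub_mono (by omega)))
        (by rw [hy]; exact inf_le_inf_right _ (x.sub_mono (by omega)))
        (hd x y h1 _ (by omega))
      refine ⟨z, ⟨⟨htop _ _, by rw [← hz n (by omega), h1], fun j hj => ?_⟩, hz.symm⟩,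
        fun w hw => ?_⟩
      · by_cases hj' : j = i + 1
        · rw [hj', hz']
          exact inf_le_left
        · rw [← hz j hj']
          exact h2 j hj hj'
      · refine (hw.2.trans hz).eq ?_
        rw [hz']
        refine eq_of_le (le_inf (hw.1.2.2 _ (by omega)) ?_) ?_
        · rw [← hw.2 n (by omega)]
          exact w.sub_mono (by omega)
        · rw [hd x y h1 _ (by omega), finrank_sub]; omega
    · refine ⟨by rw [← h' n (by omega), h.2.1], fun j hj hj' => ?_⟩
      rw [← h' j hj']
      exact h.2.2 j hj
  · symm
    refine relOp_mul_eq (fun x y h => ?_) fun x z y h h' => ?_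
    · obtain ⟨h1, h2⟩ := h
      have hb : ∀ j ≤ n, x.sub 1 ⊓ y.sub j = ⊥ := fun j hj =>
        inf_bot_mono h1 le_rfl (y.sub_mono hj)
      have hx : x.sub 1 ⊔ y.sub i = x.sub (i + 1) :=
        eq_sup_of_le (hb i (by omega)) (x.sub_mono (by omega)) (h2 i (by omega) (by omega))
          (by omega)
      obtain ⟨z, hz, hz'⟩ := x.exists_samePanel (i := i + 1) (by omega)
        (W := x.sub 1 ⊔ y.sub (i + 1))
        (by rw [← hx]; exact sup_le_sup_left (y.sub_mono (by omega)) _)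
        (sup_le (x.sub_mono (by omega))
          ((y.sub_mono (by omega)).trans (h2 (i + 2) (by omega) (by omega))))
        (by rw [finrank_sup_of_disjoint (hb _ (by omega)), finrank_sub, finrank_sub]; omega)
      refine ⟨z, ⟨hz, htop _ _, by rw [← hz 1 (by omega), h1], fun j hj => ?_⟩, fun w hw => ?_⟩
      · by_cases hj' : j = i + 1
        · rw [hj', hz']
          exact le_sup_right
        · rw [← hz (j + 1) (by omega)]
          exact h2 j hj hj'
      · refine (hw.1.symm.trans hz).eq ?_
        rw [hz']
        symm
        apply eq_sup_of_le (hb _ (by omega))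
        · rw [hw.1 1 (by omega)]
          exact w.sub_mono (by omega)
        · exact hw.2.2.2 _ (by omega)
        · omega
    · refine ⟨by rw [h 1 (by omega), h'.2.1], fun j hj hj' => ?_⟩
      rw [h (j + 1) (by omega)]
      exact h'.2.2 j hj

open Classical in
theorem card_oppA_samePanel (x y : MaxFlagA F n) {i : ℕ} (hi : i < n) :
    (Finset.univ.filter fun z => OppA x z ∧ SamePanel (i + 1) z y).card =
      if ∀ j ≤ n + 1, j ≠ i + 1 → x.sub (n + 1 - j) ⊓ y.sub j = ⊥ then Fintype.card F else 0 := by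
  have hopp : ∀ z, OppA x z ↔ ∀ j ≤ n + 1, x.sub (n + 1 - j) ⊓ z.sub j = ⊥ := fun z => by
    rw [oppA_iff]
    constructor
    · intro h j hj
      have := h (n + 1 - j) (by omega)
      rwa [show n + 1 - (n + 1 - j) = j by omega] at this
    · intro h j hj
      have := h (n + 1 - j) (by omega)
      rwa [show n + 1 - (n + 1 - j) = j by omega] at this
  split_ifs with h
  · have hL : Module.finrank F (x.sub (n - i) ⊓ y.sub (i + 2) : Submodule F _) = 1 := by
      apply le_antisymm
      · have h1 := h (i + 2) (by omega) (by omega)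
        have h2 : x.sub (n + 1 - (i + 2)) ⊓ (x.sub (n - i) ⊓ y.sub (i + 2)) = ⊥ :=
          inf_bot_mono h1 le_rfl inf_le_right
        have h3 := finrank_sup_of_disjoint h2
        have h4 : Module.finrank F (x.sub (n + 1 - (i + 2)) ⊔
            x.sub (n - i) ⊓ y.sub (i + 2) : Submodule F _) ≤ Module.finrank F (x.sub (n - i)) :=
          Submodule.finrank_mono (sup_le (x.sub_mono (by omega)) inf_le_left)
        rw [finrank_sub] at h3 h4
        omega
      · have h2 := Submodule.finrank_sup_add_finrank_inf_eq (x.sub (n - i)) (y.sub (i + 2))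
        have h3 := Submodule.finrank_le (x.sub (n - i) ⊔ y.sub (i + 2))
        rw [finrank_sub, finrank_sub] at h2
        rw [Module.finrank_fin_fun] at h3
        omega
    obtain ⟨v, hv, hspan⟩ := finrank_eq_one_iff'.1 hL
    obtain ⟨v, hvx, hvy⟩ := v
    have hv0 : v ≠ 0 := fun h => hv (Subtype.ext h)
    have hvi : v ∉ y.sub i := fun hvi => hv0 <| by
      have h1 := h i (by omega) (by omega)
      rw [← Submodule.mem_bot F, ← h1]
      exact ⟨x.sub_mono (by omega) hvx, hvi⟩
    obtain ⟨z₀, hz₀, hu⟩ := y.existsUnique_samePanel_mem hi hvi hvy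
    have : (Finset.univ.filter fun z => OppA x z ∧ SamePanel (i + 1) z y) =
        (Finset.univ.filter (SamePanel (i + 1) y)).erase z₀ := by
      ext z
      simp only [Finset.mem_filter, Finset.mem_univ, true_and, Finset.mem_erase]
      constructor
      · rintro ⟨h1, h2⟩
        refine ⟨?_, h2.symm⟩
        rintro rfl
        apply hv0
        rw [← Submodule.mem_bot F, ← (hopp z).1 h1 (i + 1) (by omega)]
        exact ⟨by rwa [show n + 1 - (i + 1) = n - i by omega], hz₀.2⟩
      · rintro ⟨h1, h2⟩
        refine ⟨(hopp z).2 fun j hj => ?_, h2.symm⟩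
        by_cases hj' : j = i + 1
        · subst hj'
          rw [show n + 1 - (i + 1) = n - i by omega, eq_bot_iff]
          rintro w ⟨hwx, hwz⟩
          obtain ⟨c, hc⟩ := hspan ⟨w, hwx, mem_sub_add_two_of_samePanel h2 hwz⟩
          have hc : c • v = w := congrArg Subtype.val hc
          by_contra hw
          have hc0 : c ≠ 0 := by
            rintro rfl
            exact hw (by rw [← hc, zero_smul]; exact zero_mem _)
          refine h1 (hu z ⟨h2, ?_⟩)
          rw [← hc] at hwz
          exact ((z.sub (i + 1)).smul_mem_iff hc0).1 hwz
        · rw [← h2 j hj']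
          exact h j hj hj'
    rw [this, Finset.card_erase_of_mem, card_samePanel y hi, Nat.add_sub_cancel]
    simpa using hz₀.1
  · rw [Finset.card_eq_zero, Finset.filter_eq_empty_iff]
    rintro z - ⟨h1, h2⟩
    apply h
    intro j hj hj'
    rw [← h2 j hj']
    exact (hopp z).1 h1 j hj

theorem oppA_mul_panel {i : ℕ} (hi : i < n) :
    relOp (OppA (F := F) (n := n)) * relOp (SamePanel (i + 1)) =
      relOp (SamePanel (n - i)) * relOp OppA := by
  classical
  refine relOp_mul_congr fun x y => ?_
  rw [card_oppA_samePanel x y hi]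
  have h1 : (Finset.univ.filter fun z => SamePanel (n - i) x z ∧ OppA z y) =
      Finset.univ.filter fun z => OppA y z ∧ SamePanel (n - i - 1 + 1) z x := by
    ext z
    simp only [Finset.mem_filter, Finset.mem_univ, true_and]
    rw [show n - i - 1 + 1 = n - i by omega]
    exact ⟨fun h => ⟨oppA_symm h.2, h.1.symm⟩, fun h => ⟨h.2.symm, oppA_symm h.1⟩⟩
  rw [h1, card_oppA_samePanel y x (by omega)]
  refine if_congr ?_ rfl rfl
  constructor
  · intro h j hj hj'
    have := h (n + 1 - j) (by omega) (by omega)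
    rwa [show n + 1 - (n + 1 - j) = j by omega, inf_comm] at this
  · intro h j hj hj'
    have := h (n + 1 - j) (by omega) (by omega)
    rwa [show n + 1 - (n + 1 - j) = j by omega, inf_comm] at this

theorem panel_mul_panel {i : ℕ} (hi : i < n) :
    relOp (SamePanel (F := F) (n := n) (i + 1)) * relOp (SamePanel (i + 1)) =
      ((Fintype.card F : ℝ) + 1) • relOp (SamePanel (i + 1)) := by
  classical
  refine LinearMap.ext fun v => ?_
  funext x
  rw [relOp_mul_apply, LinearMap.smul_apply, Pi.smul_apply, relOp_apply, smul_eq_mul,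
    Finset.mul_sum, Finset.sum_filter]
  refine Finset.sum_congr rfl fun z _ => ?_
  split_ifs with h
  · have : (Finset.univ.filter fun y => SamePanel (i + 1) x y ∧ SamePanel (i + 1) y z) =
        Finset.univ.filter (SamePanel (i + 1) x) := by
      ext y
      simp only [Finset.mem_filter, Finset.mem_univ, true_and, and_iff_left_iff_imp]
      exact fun hy => hy.symm.trans h
    rw [this, card_samePanel x hi]
    push_cast
    rfl
  · have : (Finset.univ.filter fun y => SamePanel (i + 1) x y ∧ SamePanel (i + 1) y z) = ∅ := by
      ext y
      simp only [Finset.mem_filter, Finset.mem_univ, true_and, Finset.notMem_empty, iff_false]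
      exact fun hy => h (hy.1.trans hy.2)
    rw [this]
    simp

theorem relOp_samePanel_and_ne (i : ℕ) :
    relOp (fun x y : MaxFlagA F n => SamePanel i x y ∧ x ≠ y) = relOp (SamePanel i) - 1 := by
  classical
  refine LinearMap.ext fun v => ?_
  funext x
  have : (Finset.univ.filter fun y => SamePanel i x y ∧ x ≠ y) =
      (Finset.univ.filter (SamePanel i x)).erase x := by
    ext y
    simp only [Finset.mem_filter, Finset.mem_univ, true_and, Finset.mem_erase]
    exact ⟨fun h => ⟨h.2.symm, h.1⟩, fun h => ⟨h.2, h.1.symm⟩⟩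
  rw [LinearMap.sub_apply, Pi.sub_apply, relOp_apply, relOp_apply, eq_sub_iff_add_eq,
    ← Finset.sum_erase_add (Finset.univ.filter (SamePanel i x)) v
      (by simpa using SamePanel.refl i x), ← this]
  congr!

end MaxFlagA

section Products

variable {R : Type*} [Ring R]

/-- The product `(P 1 - 1) * ⋯ * (P k - 1)`. -/
def sweepProd (P : ℕ → R) : ℕ → R
  | 0 => 1
  | k + 1 => sweepProd P k * (P (k + 1) - 1)

/-- The product `sweepProd P (k - 1) * ⋯ * sweepProd P 0`. -/
def oppProd (P : ℕ → R) : ℕ → R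
  | 0 => 1
  | k + 1 => sweepProd P k * oppProd P k

variable {M E : Type*} [AddCommGroup M] [Module ℝ M] [AddCommGroup E] [Module ℝ E]
  {P : ℕ → Module.End ℝ M} {P' : ℕ → Module.End ℝ E} {ι : E → M}

theorem sweepProd_intertwine (hι : ∀ v w, ι (v - w) = ι v - ι w)
    (h : ∀ i v, ι (P' i v) = P i (ι v)) (k : ℕ) (v : E) :
    ι (sweepProd P' k v) = sweepProd P k (ι v) := by
  induction k generalizing v with
  | zero => rfl
  | succ k ih => simp [sweepProd, ih, hι, h]

theorem oppProd_intertwine (hι : ∀ v w, ι (v - w) = ι v - ι w)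
    (h : ∀ i v, ι (P' i v) = P i (ι v)) (k : ℕ) (v : E) :
    ι (oppProd P' k v) = oppProd P k (ι v) := by
  induction k generalizing v with
  | zero => rfl
  | succ k ih => simp [oppProd, ih, sweepProd_intertwine hι h]

end Products

section Determinant

variable {M : Type*} [AddCommGroup M] [Module ℝ M] [FiniteDimensional ℝ M]

open Module in
theorem abs_det_sub_one {Q : ℝ} (hQ : 0 < Q) {P : End ℝ M} (hP : P * P = (Q + 1) • P) :
    |LinearMap.det (P - 1)| = Q ^ finrank ℝ (LinearMap.ker (P - (Q + 1) • 1)) := by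
  set K := LinearMap.ker (P - (Q + 1) • 1) with hK
  have hmem : ∀ v, v ∈ K ↔ P v = (Q + 1) • v := fun v => by
    simp [hK, LinearMap.mem_ker, sub_eq_zero]
  have hPv : ∀ v, P v ∈ K := fun v => by
    rw [hmem]
    simpa using LinearMap.congr_fun hP v
  have hle : K ≤ K.comap (P - 1) := fun v hv => by
    rw [Submodule.mem_comap, LinearMap.sub_apply]
    exact K.sub_mem (hPv v) hv
  rw [LinearMap.det_eq_det_mul_det K (P - 1) hle]
  have h1 : (P - 1).restrict (p := K) (q := K) hle = Q • LinearMap.id := by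
    ext v
    have := (hmem v).1 v.2
    simp only [LinearMap.coe_restrict_apply, LinearMap.sub_apply, this, Module.End.one_apply,
      LinearMap.smul_apply, LinearMap.id_apply, Submodule.coe_smul]
    module
  have h2 : K.mapQ K (P - 1) hle = (-1 : ℝ) • LinearMap.id := by
    ext v
    simp only [LinearMap.comp_apply, Submodule.mkQ_apply, Submodule.mapQ_apply,
      LinearMap.sub_apply, Submodule.Quotient.mk_sub, (Submodule.Quotient.mk_eq_zero K).2 (hPv v)]
    simp
  rw [h1, h2]
  simp [abs_mul, abs_of_pos hQ]

open Module in
/-- In a module without vectors fixed by the parabolic subalgebra on the generators `2, …, n`, the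
scalar by which the square of the long element acts is small. -/
theorem lt_pow_of_oppProd_sq {Q : ℝ} (hQ : 1 < Q) {n : ℕ} {P : ℕ → End ℝ M}
    (hP : ∀ i < n, P (i + 1) * P (i + 1) = (Q + 1) • P (i + 1))
    (hC : ∀ i, i + 1 < n → sweepProd P n * P (i + 1) = P (i + 2) * sweepProd P n)
    {l : ℝ} (hl : oppProd P (n + 1) * oppProd P (n + 1) = l • 1)
    (hinv : ∀ v, (∀ i, i + 1 < n → P (i + 2) v = (Q + 1) • v) → v = 0) [Nontrivial M] :
    l < Q ^ ((n - 1) * (n + 1)) := by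
  have hQ0 : 0 < Q := by linarith
  set d := finrank ℝ M with hd
  have hd0 : 0 < d := finrank_pos
  let K : ℕ → Submodule ℝ M := fun i => LinearMap.ker (P (i + 1) - (Q + 1) • 1)
  have hdet : ∀ i < n, |LinearMap.det (P (i + 1) - 1)| = Q ^ finrank ℝ (K i) := fun i hi =>
    abs_det_sub_one hQ0 (hP i hi)
  have hS0 : ∀ k ≤ n, LinearMap.det (sweepProd P k) ≠ 0 := by
    intro k
    induction k with
    | zero => simp [sweepProd]
    | succ k ih =>
      intro hk
      rw [sweepProd, map_mul]
      refine mul_ne_zero (ih (by omega)) (abs_pos.1 ?_)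
      rw [hdet k (by omega)]
      positivity
  have hm : ∀ i < n, finrank ℝ (K i) = finrank ℝ (K 0) := by
    intro i
    induction i with
    | zero => simp
    | succ i ih =>
      intro hi
      rw [← ih (by omega)]
      have h1 : sweepProd P n * (P (i + 1) - 1) = (P (i + 2) - 1) * sweepProd P n := by
        rw [mul_sub, sub_mul, hC i hi, mul_one, one_mul]
      have h2 := congrArg LinearMap.det h1
      rw [map_mul, map_mul, mul_comm] at h2
      have h3 := congrArg abs (mul_right_cancel₀ (hS0 n le_rfl) h2)
      rw [hdet i (by omega), hdet (i + 1) hi] at h3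
      exact (pow_right_injective₀ hQ0 hQ.ne' h3).symm
  set m := finrank ℝ (K 0)
  have hS : ∀ k ≤ n, |LinearMap.det (sweepProd P k)| = Q ^ (m * k) := by
    intro k
    induction k with
    | zero => simp [sweepProd]
    | succ k ih =>
      intro hk
      rw [sweepProd, map_mul, abs_mul, ih (by omega), hdet k (by omega), hm k (by omega),
        ← pow_add]
      congr 1
  have hO : ∀ k ≤ n + 1, |LinearMap.det (oppProd P k)| = Q ^ (m * k.choose 2) := by
    intro k
    induction k with
    | zero => simp [oppProd]
    | succ k ih =>
      intro hk
      rw [oppProd, map_mul, abs_mul, ih (by omega), hS k (by omega), ← pow_add,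
        Nat.choose_succ_succ' k 1, Nat.choose_one_right, mul_add]
  have hld : l ^ d = Q ^ (m * (n * (n + 1))) := by
    have h1 := congrArg LinearMap.det hl
    rw [map_mul, ← abs_mul_abs_self, hO _ le_rfl, ← pow_add, LinearMap.det_smul, map_one,
      mul_one] at h1
    rw [hd, ← h1, ← mul_add, ← two_mul]
    congr 2
    rw [Nat.choose_two_right, Nat.add_sub_cancel, mul_comm (n + 1) n]
    have h2 := Nat.div_mul_cancel (Nat.even_mul_succ_self n).two_dvd
    omega
  have hbound : d ≤ (n - 1) * (d - m) := by
    let f : M →ₗ[ℝ] ((i : Fin (n - 1)) → M ⧸ K (i + 1)) := LinearMap.pi fun i => (K (i + 1)).mkQ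
    have hf : Function.Injective f := by
      rw [← LinearMap.ker_eq_bot, eq_bot_iff]
      intro v hv
      refine hinv v fun i hi => ?_
      have h1 := congrFun (LinearMap.mem_ker.1 hv) ⟨i, by omega⟩
      have h2 : v ∈ K (i + 1) := by simpa [f] using h1
      simpa [K, sub_eq_zero] using h2
    refine (LinearMap.finrank_le_finrank_of_injective hf).trans_eq ?_
    rw [finrank_pi_fintype]
    have : ∀ i : Fin (n - 1), finrank ℝ (M ⧸ K (i + 1)) = d - m := fun i => by
      have h1 := (K (i + 1)).finrank_quotient_add_finrank
      rw [hm _ (by omega)] at h1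
      omega
    simp [this]
  by_contra! hcon
  have h1 : Q ^ ((n - 1) * (n + 1) * d) ≤ Q ^ (m * (n * (n + 1))) := by
    rw [← hld, pow_mul]
    exact pow_le_pow_left₀ (by positivity) hcon d
  have h2 := (pow_le_pow_iff_right₀ hQ).1 h1
  obtain ⟨k, rfl⟩ : ∃ k, n = k + 1 := ⟨n - 1, by
    rcases n with - | n
    · simp at hbound; omega
    · simp⟩
  simp only [Nat.add_sub_cancel] at hbound h2
  have hmd : m ≤ d := Submodule.finrank_le _
  obtain ⟨e, he⟩ := Nat.exists_eq_add_of_le hmd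
  rw [he, Nat.add_sub_cancel_left] at hbound
  have h3 : k * d ≤ m * (k + 1) := by
    refine Nat.le_of_mul_le_mul_right (c := k + 1 + 1) ?_ (by omega)
    calc _ = k * (k + 1 + 1) * d := by ring
      _ ≤ _ := h2
      _ = _ := by ring
  rw [he] at h3
  have he0 : 0 < e := by
    rcases Nat.eq_zero_or_pos e with rfl | h
    · simp at hbound; omega
    · exact h
  nlinarith

end Determinant

section Products

variable {M : Type*} [AddCommGroup M] [Module ℝ M] {P : ℕ → Module.End ℝ M} {Q : ℝ} {n : ℕ}

theorem sweepProd_smul {v : M} (h : ∀ i < n, P (i + 1) v = (Q + 1) • v) {k : ℕ} (hk : k ≤ n) :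
    sweepProd P k v = Q ^ k • v := by
  induction k with
  | zero => simp [sweepProd]
  | succ k ih =>
    have h1 : (P (k + 1) - 1) v = Q • v := by
      rw [LinearMap.sub_apply, h k hk, Module.End.one_apply]; module
    rw [sweepProd, Module.End.mul_apply, h1, map_smul, ih (by omega), smul_smul, pow_succ']

variable {e : ℕ → M}

theorem sweepProd_of_lt (h : ∀ i < n, ∀ j ≤ n + 1, j ≠ i + 1 → P (i + 1) (e j) = (Q + 1) • e j)
    {k j : ℕ} (hkj : k < j) (hj : j ≤ n + 1) : sweepProd P k (e j) = Q ^ k • e j :=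
  sweepProd_smul (n := k) (fun i hi => h i (by omega) j hj (by omega)) le_rfl

theorem sweepProd_of_le (h : ∀ i < n, ∀ j ≤ n + 1, j ≠ i + 1 → P (i + 1) (e j) = (Q + 1) • e j)
    (h' : ∀ i < n, P (i + 1) (e (i + 1)) = e (i + 2) + Q • e i) (h0 : e 0 = 0) {k j : ℕ}
    (hjk : j ≤ k) (hk : k ≤ n) : Q • sweepProd P k (e j) = Q ^ k • (e (j + 1) - e 1) := by
  induction k generalizing j with
  | zero => simp [Nat.le_zero.1 hjk, h0]
  | succ k ih =>
    rw [sweepProd, Module.End.mul_apply, LinearMap.sub_apply, Module.End.one_apply]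
    rcases Nat.lt_or_eq_of_le hjk with hlt | rfl
    · have h1 : P (k + 1) (e j) - e j = Q • e j := by
        rw [h k hk j (by omega) (by omega)]; module
      rw [h1, map_smul, ih (by omega) (by omega), smul_smul, pow_succ']
    · rw [h' k hk, map_sub, map_add, map_smul, ih le_rfl (by omega),
        sweepProd_of_lt h (by omega) (by omega), sweepProd_of_lt h (by omega) (by omega), pow_succ]
      module

theorem oppProd_of_le (h : ∀ i < n, ∀ j ≤ n + 1, j ≠ i + 1 → P (i + 1) (e j) = (Q + 1) • e j)
    {k j : ℕ} (hkj : k ≤ j) (hj : j ≤ n + 1) : oppProd P k (e j) = Q ^ k.choose 2 • e j := by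
  induction k with
  | zero => simp [oppProd]
  | succ k ih =>
    rw [oppProd, Module.End.mul_apply, ih (by omega), map_smul, sweepProd_of_lt h hkj hj, smul_smul,
      ← pow_add, Nat.choose_succ_succ' k 1, Nat.choose_one_right, add_comm]

theorem oppProd_of_ge (h : ∀ i < n, ∀ j ≤ n + 1, j ≠ i + 1 → P (i + 1) (e j) = (Q + 1) • e j)
    (h' : ∀ i < n, P (i + 1) (e (i + 1)) = e (i + 2) + Q • e i) (h0 : e 0 = 0) {k j : ℕ}
    (hjk : j ≤ k) (hk : k ≤ n + 1) :
    Q ^ (k - j) • oppProd P k (e j) = Q ^ k.choose 2 • (e k - e (k - j)) := by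
  induction k, hjk using Nat.le_induction with
  | base => simp [h0, oppProd_of_le h le_rfl hk]
  | succ k hjk ih =>
    rw [oppProd, Module.End.mul_apply, Nat.sub_add_comm hjk, pow_succ', mul_smul, ← map_smul,
      ih (by omega), map_smul, smul_comm, map_sub, smul_sub,
      sweepProd_of_le h h' h0 le_rfl (by omega), sweepProd_of_le h h' h0 (Nat.sub_le k j) (by omega),
      Nat.choose_succ_succ' k 1, Nat.choose_one_right, pow_add]
    module

end Products

namespace MaxFlagA

open scoped LinearAlgebra.Projectivization

variable {F : Type} [Field F] [Fintype F] {n : ℕ}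

/-- The operator summing a function on flags over the `i`-panels. -/
noncomputable def panelOp (F : Type) [Field F] [Fintype F] (n i : ℕ) :
    Module.End ℝ (MaxFlagA F n → ℝ) :=
  relOp (SamePanel i)

theorem relOp_sweep_eq {k : ℕ} (hk : k ≤ n) :
    relOp (Sweep k) = sweepProd (panelOp F n) k := by
  induction k with
  | zero => rw [relOp_congr fun _ _ => sweep_zero_iff, relOp_eq, sweepProd]
  | succ k ih => rw [← relOp_sweep_succ hk, ih (by omega), relOp_samePanel_and_ne]; rfl

theorem relOp_partOpp_eq {k : ℕ} (hk : k ≤ n + 1) :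
    relOp (PartOpp k) = oppProd (panelOp F n) k := by
  induction k with
  | zero => rw [relOp_congr fun _ _ => partOpp_zero_iff, relOp_eq, oppProd]
  | succ k ih => rw [← relOp_partOpp_succ (by omega), relOp_sweep_eq (by omega), ih (by omega)]; rfl

theorem relOp_oppA_eq : relOp (OppA (F := F) (n := n)) = oppProd (panelOp F n) (n + 1) := by
  rw [← relOp_partOpp_eq le_rfl, relOp_congr fun _ _ => partOpp_last_iff]

theorem panelOp_eq_one {i : ℕ} (hi : i = 0 ∨ n < i) : panelOp F n i = 1 := by
  rw [← relOp_eq, panelOp]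
  refine relOp_congr fun x y => ⟨fun h => h.eq ?_, fun h => h ▸ SamePanel.refl i x⟩
  rcases hi with rfl | hi
  · rw [sub_zero, sub_zero]
  · rw [sub_of_le _ hi, sub_of_le _ hi]

theorem panelOp_of_const {i : ℕ} (hi : i < n) {v : MaxFlagA F n → ℝ}
    (h : ∀ x y, SamePanel (i + 1) x y → v x = v y) :
    panelOp F n (i + 1) v = ((Fintype.card F : ℝ) + 1) • v := by
  classical
  funext x
  rw [panelOp, relOp_apply, Finset.sum_congr rfl fun y hy => (h x y (by simpa using hy)).symm,
    Finset.sum_const, nsmul_eq_mul, Pi.smul_apply, smul_eq_mul]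
  congr 1
  rw [← Nat.cast_succ, Nat.cast_inj, Nat.succ_eq_add_one, ← card_samePanel x hi]

theorem eq_of_panelOp_eq {i : ℕ} {v : MaxFlagA F n → ℝ}
    (h : panelOp F n i v = ((Fintype.card F : ℝ) + 1) • v) {x y : MaxFlagA F n}
    (hxy : SamePanel i x y) : v x = v y := by
  classical
  have h1 : panelOp F n i v x = panelOp F n i v y := by
    simp only [panelOp, relOp_apply]
    refine Finset.sum_congr (Finset.filter_congr fun z _ => ?_) fun _ _ => rfl
    exact ⟨hxy.symm.trans, hxy.trans⟩
  rw [h] at h1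
  exact mul_left_cancel₀ (by positivity) h1

noncomputable instance : Fintype (ℙ F (Fin (n + 1) → F)) := Fintype.ofFinite _

open Classical in
/-- The operator sending a function `f` on points to the function on flags whose value is the sum
of `f` over the points in the `k`-dimensional member. -/
noncomputable def pointSum (k : ℕ) :
    (ℙ F (Fin (n + 1) → F) → ℝ) →ₗ[ℝ] (MaxFlagA F n → ℝ) where
  toFun f x := ∑ p, if p.rep ∈ x.sub k then f p else 0
  map_add' f g := by
    ext x
    rw [Pi.add_apply, ← Finset.sum_add_distrib]
    refine Finset.sum_congr rfl fun p _ => ?_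
    split <;> simp
  map_smul' c f := by
    ext x
    rw [Pi.smul_apply, RingHom.id_apply, smul_eq_mul, Finset.mul_sum]
    refine Finset.sum_congr rfl fun p _ => ?_
    split <;> simp

open Classical in
theorem pointSum_apply (k : ℕ) (f : ℙ F (Fin (n + 1) → F) → ℝ) (x : MaxFlagA F n) :
    pointSum k f x = ∑ p, if p.rep ∈ x.sub k then f p else 0 := rfl

theorem pointSum_zero (f : ℙ F (Fin (n + 1) → F) → ℝ) : pointSum 0 f = 0 := by
  funext x
  simp [pointSum_apply, sub_zero, Projectivization.rep_nonzero]

theorem pointSum_last (f : ℙ F (Fin (n + 1) → F) → ℝ) :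
    pointSum (n + 1) f = fun _ => ∑ p, f p := by
  funext x
  simp [pointSum_apply, sub_of_le]

theorem panelOp_pointSum_of_ne {i j : ℕ} (hi : i < n) (hj : j ≠ i + 1)
    (f : ℙ F (Fin (n + 1) → F) → ℝ) :
    panelOp F n (i + 1) (pointSum j f) = ((Fintype.card F : ℝ) + 1) • pointSum j f :=
  panelOp_of_const hi fun x y h => by rw [pointSum_apply, pointSum_apply, h j hj]

theorem panelOp_pointSum_self {i : ℕ} (hi : i < n) (f : ℙ F (Fin (n + 1) → F) → ℝ) :
    panelOp F n (i + 1) (pointSum (i + 1) f) =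
      pointSum (i + 2) f + (Fintype.card F : ℝ) • pointSum i f := by
  classical
  funext x
  simp only [panelOp, relOp_apply, Pi.add_apply, Pi.smul_apply, pointSum_apply, smul_eq_mul]
  rw [Finset.sum_comm, Finset.mul_sum, ← Finset.sum_add_distrib]
  refine Finset.sum_congr rfl fun p _ => ?_
  rw [← Finset.sum_filter, Finset.filter_filter, Finset.sum_const, nsmul_eq_mul]
  by_cases h1 : p.rep ∈ x.sub i
  · have h2 : p.rep ∈ x.sub (i + 2) := x.sub_mono (by omega) h1
    have h3 : (Finset.univ.filter fun y => SamePanel (i + 1) x y ∧ p.rep ∈ y.sub (i + 1)).card =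
        Fintype.card F + 1 := by
      rw [← card_samePanel x hi]
      congr 1
      refine Finset.filter_congr fun y _ => and_iff_left_of_imp fun h => ?_
      rw [h i (by omega)] at h1
      exact y.sub_mono (by omega) h1
    rw [if_pos h1, if_pos h2, h3]
    push_cast
    ring
  · by_cases h2 : p.rep ∈ x.sub (i + 2)
    · have h3 : (Finset.univ.filter fun y => SamePanel (i + 1) x y ∧ p.rep ∈ y.sub (i + 1)).card =
          1 := by
        rw [Finset.card_eq_one]
        obtain ⟨y, hy, huniq⟩ := x.existsUnique_samePanel_mem hi h1 h2
        refine ⟨y, ?_⟩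
        ext z
        simp only [Finset.mem_filter, Finset.mem_univ, true_and, Finset.mem_singleton]
        exact ⟨huniq z, fun h => h ▸ hy⟩
      rw [if_neg h1, if_pos h2, h3]
      simp
    · have h3 : (Finset.univ.filter fun y => SamePanel (i + 1) x y ∧ p.rep ∈ y.sub (i + 1)).card =
          0 := by
        rw [Finset.card_eq_zero, Finset.filter_eq_empty_iff]
        exact fun y _ h => h2 (mem_sub_add_two_of_samePanel h.1 h.2)
      rw [if_neg h1, if_neg h2, h3]
      simp

theorem pow_smul_oppA_pointSum {k : ℕ} (hk : k ≤ n + 1) (f : ℙ F (Fin (n + 1) → F) → ℝ) :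
    (Fintype.card F : ℝ) ^ (n + 1 - k) • relOp OppA (pointSum k f) =
      (Fintype.card F : ℝ) ^ (n + 1).choose 2 • (pointSum (n + 1) f - pointSum (n + 1 - k) f) := by
  rw [relOp_oppA_eq]
  exact oppProd_of_ge (e := fun k => pointSum k f)
    (fun i hi j _ hne => panelOp_pointSum_of_ne hi hne f)
    (fun i hi => panelOp_pointSum_self hi f) (pointSum_zero f) hk le_rfl

theorem relOp_oppA_const (c : ℝ) :
    relOp OppA (fun _ : MaxFlagA F n => c) =
      (Fintype.card F : ℝ) ^ (n + 1).choose 2 • fun _ => c := by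
  have h := pow_smul_oppA_pointSum (F := F) (n := n) le_rfl
    (fun _ => c / Fintype.card (ℙ F (Fin (n + 1) → F)))
  simp only [pointSum_last, Nat.sub_self, pointSum_zero] at h
  have h1 : (Fintype.card (ℙ F (Fin (n + 1) → F)) : ℝ) ≠ 0 := by
    simp
  simpa [mul_div_cancel₀ _ h1] using h

instance : Nonempty (MaxFlagA F n) := by
  let b := Pi.basisFun F (Fin (n + 1))
  refine ⟨⟨b.flag, b.flag_mono, fun k => ?_⟩⟩
  induction k using Fin.induction with
  | zero => simp
  | succ k ih =>
    rw [b.flag_succ, sup_comm, Submodule.finrank_sup_span_singleton, ih]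
    · simp
    · rw [b.self_mem_flag_iff]
      exact lt_irrefl _

omit [Fintype F] in
theorem sub_one_eq_of_rep_mem {x : MaxFlagA F n} {p : ℙ F (Fin (n + 1) → F)}
    (h : p.rep ∈ x.sub 1) : x.sub 1 = p.submodule := by
  symm
  apply Submodule.eq_of_le_of_finrank_eq
  · rwa [Projectivization.submodule_eq, Submodule.span_singleton_le_iff_mem]
  · rw [Projectivization.finrank_submodule, finrank_sub]; simp

omit [Fintype F] in
theorem exists_sub_one_eq (p : ℙ F (Fin (n + 1) → F)) :
    ∃ x : MaxFlagA F n, x.sub 1 = p.submodule := by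
  obtain ⟨x, -, hx⟩ := exists_linked_mem (Classical.arbitrary (MaxFlagA F n)) 0 p.rep
  exact ⟨x, sub_one_eq_of_rep_mem hx⟩

theorem pointSum_one_eq {x : MaxFlagA F n} {p : ℙ F (Fin (n + 1) → F)}
    (hx : x.sub 1 = p.submodule) (f : ℙ F (Fin (n + 1) → F) → ℝ) : pointSum 1 f x = f p := by
  classical
  rw [pointSum_apply, Finset.sum_eq_single p]
  · rw [if_pos]
    rw [hx, Projectivization.submodule_eq]
    exact Submodule.mem_span_singleton_self _
  · intro r _ hr
    refine if_neg fun h => hr ?_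
    exact Projectivization.submodule_injective ((sub_one_eq_of_rep_mem h).symm.trans hx)
  · simp

end MaxFlagA

namespace MaxFlagA

open scoped LinearAlgebra.Projectivization

variable {F : Type} [Field F] [Fintype F] {n : ℕ}

/-- The functions on points with sum zero. -/
noncomputable def sumZero (F : Type) [Field F] [Fintype F] (n : ℕ) :
    Submodule ℝ (ℙ F (Fin (n + 1) → F) → ℝ) :=
  LinearMap.ker (Fintype.linearCombination ℝ fun _ => (1 : ℝ))

theorem mem_sumZero {f : ℙ F (Fin (n + 1) → F) → ℝ} : f ∈ sumZero F n ↔ ∑ p, f p = 0 := by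
  simp [sumZero, Fintype.linearCombination_apply]

theorem finrank_sumZero :
    Module.finrank ℝ (sumZero F n) + 1 = Nat.card (ℙ F (Fin (n + 1) → F)) := by
  have h := (Fintype.linearCombination ℝ
    fun _ : ℙ F (Fin (n + 1) → F) => (1 : ℝ)).finrank_range_add_finrank_ker
  rw [LinearMap.range_eq_top.2, finrank_top, Module.finrank_self, Module.finrank_pi,
    ← Nat.card_eq_fintype_card, add_comm] at h
  · exact h
  · classical
    intro c
    exact ⟨Pi.single (Classical.arbitrary _) c, by simp [Fintype.linearCombination_apply]⟩

theorem pointSum_of_lt {k : ℕ} (hk : n < k) {f : ℙ F (Fin (n + 1) → F) → ℝ}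
    (hf : f ∈ sumZero F n) : pointSum k f = 0 := by
  funext x
  simpa [pointSum_apply, sub_of_le _ hk] using mem_sumZero.1 hf

theorem one_lt_q (F : Type) [Field F] [Fintype F] : (1 : ℝ) < Fintype.card F := by
  exact_mod_cast Fintype.one_lt_card

theorem q_pos (F : Type) [Field F] [Fintype F] : (0 : ℝ) < Fintype.card F :=
  one_pos.trans (one_lt_q F)

/-- The opposition operator sends `pointSum k f` to a multiple of `pointSum (n + 1 - k) f`; this is
the negative of the scalar. -/
noncomputable def oppScalar (F : Type) [Fintype F] (n k : ℕ) : ℝ :=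
  (Fintype.card F : ℝ) ^ (n + 1).choose 2 / (Fintype.card F : ℝ) ^ (n + 1 - k)

theorem oppScalar_pos (k : ℕ) : 0 < oppScalar F n k := by
  have := q_pos F
  unfold oppScalar
  positivity

theorem two_mul_choose_two : (n + 1).choose 2 + (n + 1).choose 2 = n * (n + 1) := by
  rw [Nat.choose_two_right, Nat.add_sub_cancel, mul_comm (n + 1) n]
  have h2 := Nat.div_mul_cancel (Nat.even_mul_succ_self n).two_dvd
  omega

theorem oppScalar_mul (hn : 1 ≤ n) {k : ℕ} (hk : k ≤ n + 1) :
    oppScalar F n k * oppScalar F n (n + 1 - k) =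
      (Fintype.card F : ℝ) ^ ((n - 1) * (n + 1)) := by
  have := q_pos F
  rw [oppScalar, oppScalar, div_mul_div_comm, ← pow_add, ← pow_add, two_mul_choose_two,
    div_eq_iff (by positivity), ← pow_add]
  congr 1
  obtain ⟨m, rfl⟩ := Nat.exists_eq_add_of_le' hn
  have h : m + 1 + 1 - k + (m + 1 + 1 - (m + 1 + 1 - k)) = m + 2 := by omega
  rw [h, Nat.add_sub_cancel]
  ring

theorem oppA_pointSum {k : ℕ} (hk : k ≤ n + 1) {f : ℙ F (Fin (n + 1) → F) → ℝ}
    (hf : f ∈ sumZero F n) :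
    relOp OppA (pointSum k f) = -oppScalar F n k • pointSum (n + 1 - k) f := by
  have hq := q_pos F
  have h := pow_smul_oppA_pointSum hk f
  rw [pointSum_of_lt (Nat.lt_succ_self n) hf, zero_sub] at h
  refine smul_right_injective _ (pow_pos hq (n + 1 - k)).ne' (h.trans ?_)
  simp only [smul_smul, oppScalar, smul_neg, neg_smul]
  rw [mul_div_cancel₀ _ (pow_pos hq _).ne']

/-- The span of the functions `pointSum k f`, where `f` has sum zero. -/
noncomputable def pointSpace (F : Type) [Field F] [Fintype F] (n : ℕ) :
    Submodule ℝ (MaxFlagA F n → ℝ) :=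
  ⨆ k, (sumZero F n).map (pointSum k)

theorem pointSum_mem (k : ℕ) {f : ℙ F (Fin (n + 1) → F) → ℝ} (hf : f ∈ sumZero F n) :
    pointSum k f ∈ pointSpace F n :=
  Submodule.mem_iSup_of_mem k (Submodule.mem_map_of_mem hf)

theorem pointSpace_le {p : Submodule ℝ (MaxFlagA F n → ℝ)}
    (h : ∀ k, 1 ≤ k → k ≤ n → ∀ f ∈ sumZero F n, pointSum k f ∈ p) : pointSpace F n ≤ p := by
  refine iSup_le fun k => ?_
  rw [Submodule.map_le_iff_le_comap]
  intro f hf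
  rw [Submodule.mem_comap]
  rcases Nat.eq_zero_or_pos k with rfl | hk
  · rw [pointSum_zero]; exact zero_mem p
  · by_cases hk' : k ≤ n
    · exact h k hk hk' f hf
    · rw [pointSum_of_lt (by omega) hf]; exact zero_mem p

theorem oppA_mem_pointSpace {v : MaxFlagA F n → ℝ} (hv : v ∈ pointSpace F n) :
    relOp OppA v ∈ pointSpace F n := by
  refine pointSpace_le (p := (pointSpace F n).comap (relOp OppA)) (fun k _ hk f hf => ?_) hv
  rw [Submodule.mem_comap, oppA_pointSum (by omega) hf]
  exact Submodule.smul_mem _ _ (pointSum_mem _ hf)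

theorem oppA_oppA_of_mem_pointSpace (hn : 1 ≤ n) {v : MaxFlagA F n → ℝ}
    (hv : v ∈ pointSpace F n) :
    relOp OppA (relOp OppA v) = (Fintype.card F : ℝ) ^ ((n - 1) * (n + 1)) • v := by
  suffices h : pointSpace F n ≤ LinearMap.eqLocus (relOp OppA * relOp OppA)
      ((Fintype.card F : ℝ) ^ ((n - 1) * (n + 1)) • 1) from h hv
  refine pointSpace_le fun k _ hk f hf => ?_
  simp only [LinearMap.mem_eqLocus, Module.End.mul_apply, LinearMap.smul_apply,
    Module.End.one_apply]
  rw [oppA_pointSum (by omega) hf, map_smul, oppA_pointSum (by omega) hf, smul_smul, neg_mul_neg,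
    oppScalar_mul hn (by omega), Nat.sub_sub_self (by omega)]

theorem panelOp_mem_pointSpace {v : MaxFlagA F n → ℝ} (hv : v ∈ pointSpace F n) (i : ℕ) :
    panelOp F n i v ∈ pointSpace F n := by
  by_cases hi : i = 0 ∨ n < i
  · rwa [panelOp_eq_one hi]
  obtain ⟨i, rfl⟩ := Nat.exists_eq_succ_of_ne_zero (mt Or.inl hi)
  have hin : i < n := by omega
  refine pointSpace_le (p := (pointSpace F n).comap (panelOp F n (i + 1)))
    (fun k _ hk f hf => ?_) hv
  rw [Submodule.mem_comap]
  by_cases h : k = i + 1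
  · rw [h, panelOp_pointSum_self hin]
    exact add_mem (pointSum_mem _ hf) (Submodule.smul_mem _ _ (pointSum_mem _ hf))
  · rw [panelOp_pointSum_of_ne hin h]
    exact Submodule.smul_mem _ _ (pointSum_mem _ hf)

theorem pointSum_one_const (c : ℝ) :
    pointSum 1 (fun _ : ℙ F (Fin (n + 1) → F) => c) = fun _ => c := by
  funext x
  have h : Module.finrank F (x.sub 1) = 1 := by rw [finrank_sub]; simp
  exact pointSum_one_eq (Projectivization.submodule_mk'' _ h).symm _

/-- The sum of `pointSpace F n` and the constant functions. -/
noncomputable def pointSpaceC (F : Type) [Field F] [Fintype F] (n : ℕ) :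
    Submodule ℝ (MaxFlagA F n → ℝ) :=
  pointSpace F n ⊔ Submodule.span ℝ {1}

theorem mem_pointSpaceC {v : MaxFlagA F n → ℝ} :
    v ∈ pointSpaceC F n ↔ ∃ w ∈ pointSpace F n, ∃ c : ℝ, v = w + c • 1 := by
  simp [pointSpaceC, Submodule.mem_sup, Submodule.mem_span_singleton, eq_comm]

theorem panelOp_mem_pointSpaceC {v : MaxFlagA F n → ℝ} (hv : v ∈ pointSpaceC F n) (i : ℕ) :
    panelOp F n i v ∈ pointSpaceC F n := by
  by_cases hi : i = 0 ∨ n < i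
  · rwa [panelOp_eq_one hi]
  obtain ⟨i, rfl⟩ := Nat.exists_eq_succ_of_ne_zero (mt Or.inl hi)
  obtain ⟨w, hw, c, rfl⟩ := mem_pointSpaceC.1 hv
  refine mem_pointSpaceC.2 ⟨_, panelOp_mem_pointSpace hw (i + 1), c * (Fintype.card F + 1), ?_⟩
  rw [map_add, map_smul, panelOp_of_const (v := 1) (by omega) fun _ _ _ => rfl, smul_smul]

theorem oppA_one :
    relOp OppA (1 : MaxFlagA F n → ℝ) = (Fintype.card F : ℝ) ^ (n + 1).choose 2 • 1 :=
  relOp_oppA_const 1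

theorem oppA_mem_pointSpaceC {v : MaxFlagA F n → ℝ} (hv : v ∈ pointSpaceC F n) :
    relOp OppA v ∈ pointSpaceC F n := by
  obtain ⟨w, hw, c, rfl⟩ := mem_pointSpaceC.1 hv
  refine mem_pointSpaceC.2 ⟨_, oppA_mem_pointSpace hw,
    c * (Fintype.card F : ℝ) ^ (n + 1).choose 2, ?_⟩
  rw [map_add, map_smul, oppA_one, smul_smul]

theorem pointSum_one_mem (f : ℙ F (Fin (n + 1) → F) → ℝ) : pointSum 1 f ∈ pointSpaceC F n := by
  set c := (∑ p, f p) / Fintype.card (ℙ F (Fin (n + 1) → F))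
  have h1 : f - (fun _ => c) ∈ sumZero F n := by
    rw [mem_sumZero]
    have h2 : (Fintype.card (ℙ F (Fin (n + 1) → F)) : ℝ) ≠ 0 := by simp
    simp [c, mul_div_cancel₀ _ h2]
  refine mem_pointSpaceC.2 ⟨_, pointSum_mem 1 h1, c, ?_⟩
  rw [map_sub, pointSum_one_const]
  ext x
  simp

/-- The functions orthogonal to `pointSpaceC F n`. -/
noncomputable def pointSpaceOrth (F : Type) [Field F] [Fintype F] (n : ℕ) :
    Submodule ℝ (MaxFlagA F n → ℝ) :=
  LinearMap.BilinForm.orthogonal (dotProductBilin ℝ ℝ) (pointSpaceC F n)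

theorem mem_pointSpaceOrth {v : MaxFlagA F n → ℝ} :
    v ∈ pointSpaceOrth F n ↔ ∀ w ∈ pointSpaceC F n, w ⬝ᵥ v = 0 := Iff.rfl

theorem eq_zero_of_mem_pointSpaceC_of_mem_orth {v : MaxFlagA F n → ℝ} (hv : v ∈ pointSpaceC F n)
    (hv' : v ∈ pointSpaceOrth F n) : v = 0 :=
  dotProduct_self_eq_zero.1 (mem_pointSpaceOrth.1 hv' v hv)

theorem exists_add_of_orth (v : MaxFlagA F n → ℝ) :
    ∃ w ∈ pointSpaceC F n, ∃ u ∈ pointSpaceOrth F n, v = w + u := by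
  have h1 : IsCompl (pointSpaceC F n) (pointSpaceOrth F n) := by
    refine (LinearMap.BilinForm.isCompl_orthogonal_iff_disjoint fun u w h => ?_).2 ?_
    · exact (dotProduct_comm w u).trans h
    · exact Submodule.disjoint_def.2 fun u => eq_zero_of_mem_pointSpaceC_of_mem_orth
  obtain ⟨w, hw, u, hu, h⟩ := Submodule.mem_sup.1 (h1.sup_eq_top.ge (Submodule.mem_top (x := v)))
  exact ⟨w, hw, u, hu, h.symm⟩

theorem relOp_mem_orth {r : MaxFlagA F n → MaxFlagA F n → Prop} (hr : ∀ x y, r x y → r y x)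
    (h : ∀ v ∈ pointSpaceC F n, relOp r v ∈ pointSpaceC F n) {v : MaxFlagA F n → ℝ}
    (hv : v ∈ pointSpaceOrth F n) : relOp r v ∈ pointSpaceOrth F n := by
  rw [mem_pointSpaceOrth] at hv ⊢
  intro w hw
  rw [← relOp_dotProduct hr]
  exact hv _ (h w hw)

theorem eq_zero_of_panelOp_eq {v : MaxFlagA F n → ℝ} (hv : v ∈ pointSpaceOrth F n)
    (h : ∀ i, i + 1 < n → panelOp F n (i + 2) v = ((Fintype.card F : ℝ) + 1) • v) : v = 0 := by
  have h1 : ∀ x y : MaxFlagA F n, Linked 1 x y → v x = v y := by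
    intro x y hxy
    induction hxy with
    | refl => rfl
    | tail _ hbc ih =>
      obtain ⟨i, hi, hi', hs⟩ := hbc
      obtain ⟨i, rfl⟩ := Nat.exists_eq_add_of_le' (show 2 ≤ i from hi)
      exact ih.trans (eq_of_panelOp_eq (h i (by omega)) hs)
  choose g hg using exists_sub_one_eq (F := F) (n := n)
  refine eq_zero_of_mem_pointSpaceC_of_mem_orth ?_ hv
  convert pointSum_one_mem fun p => v (g p) using 1
  funext x
  have h2 : Module.finrank F (x.sub 1) = 1 := by rw [finrank_sub]; simp
  have h3 := Projectivization.submodule_mk'' _ h2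
  rw [pointSum_one_eq h3.symm]
  refine h1 _ _ (linked_of_sub_eq fun j hj => ?_)
  interval_cases j
  · rw [sub_zero, sub_zero]
  · rw [hg, h3]

theorem commute_oppA_sq_panelOp (i : ℕ) :
    Commute (relOp OppA * relOp OppA) (panelOp F n i) := by
  by_cases hi : i = 0 ∨ n < i
  · rw [panelOp_eq_one hi]
    exact Commute.one_right _
  obtain ⟨i, rfl⟩ := Nat.exists_eq_succ_of_ne_zero (mt Or.inl hi)
  have h1 := oppA_mul_panel (F := F) (show i < n by omega)
  have h2 := oppA_mul_panel (F := F) (show n - i - 1 < n by omega)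
  rw [show n - i - 1 + 1 = n - i by omega, show n - (n - i - 1) = i + 1 by omega] at h2
  rw [Commute, SemiconjBy, panelOp, mul_assoc, h1, ← mul_assoc, h2, mul_assoc]

theorem sq_lt_of_mem_orth {v : MaxFlagA F n → ℝ} (hv : v ∈ pointSpaceOrth F n) (hv0 : v ≠ 0)
    {l : ℝ} (hl : relOp OppA v = l • v) :
    l ^ 2 < (Fintype.card F : ℝ) ^ ((n - 1) * (n + 1)) := by
  let E : Submodule ℝ (MaxFlagA F n → ℝ) :=
    pointSpaceOrth F n ⊓ LinearMap.ker (relOp OppA * relOp OppA - l ^ 2 • 1)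
  have hE : ∀ i, ∀ w ∈ E, panelOp F n i w ∈ E := by
    refine fun i w hw => ⟨relOp_mem_orth (fun _ _ => SamePanel.symm)
      (fun u hu => panelOp_mem_pointSpaceC hu i) hw.1, LinearMap.mem_ker.2 ?_⟩
    have h1 : Commute (relOp OppA * relOp OppA - l ^ 2 • 1) (panelOp F n i) :=
      (commute_oppA_sq_panelOp i).sub_left ((Commute.one_left _).smul_left _)
    rw [← Module.End.mul_apply, h1.eq, Module.End.mul_apply,
      LinearMap.mem_ker.1 hw.2, map_zero]
  have hvE : v ∈ E := by
    refine ⟨hv, ?_⟩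
    simp [hl, smul_smul, sq]
  let P : ℕ → Module.End ℝ E := fun i => (panelOp F n i).restrict (hE i)
  have hsw := sweepProd_intertwine (P := panelOp F n) (P' := P) (ι := E.subtype)
    (fun _ _ => rfl) (fun _ _ => rfl)
  have hop := oppProd_intertwine (P := panelOp F n) (P' := P) (ι := E.subtype)
    (fun _ _ => rfl) (fun _ _ => rfl)
  have : Nontrivial E := ⟨⟨⟨v, hvE⟩, 0, fun h => hv0 (congrArg Subtype.val h)⟩⟩
  refine lt_pow_of_oppProd_sq (one_lt_q F) (P := P) (fun i hi => ?_) (fun i hi => ?_) ?_ ?_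
  · refine LinearMap.ext fun w => E.subtype_injective ?_
    exact LinearMap.congr_fun (panel_mul_panel hi) (w : MaxFlagA F n → ℝ)
  · refine LinearMap.ext fun w => E.subtype_injective ?_
    have h1 := LinearMap.congr_fun (sweep_mul_panel (F := F) hi) (w : MaxFlagA F n → ℝ)
    rw [relOp_sweep_eq le_rfl] at h1
    rw [Module.End.mul_apply, hsw]
    refine h1.trans ?_
    rw [Module.End.mul_apply, Module.End.mul_apply]
    exact congrArg _ (hsw n w).symm
  · refine LinearMap.ext fun w => E.subtype_injective ?_
    rw [Module.End.mul_apply, hop, hop, ← relOp_oppA_eq]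
    simpa [sub_eq_zero] using w.2.2
  · intro w hw
    refine E.subtype_injective (eq_zero_of_panelOp_eq w.2.1 fun i hi => ?_)
    exact congrArg Subtype.val (hw i hi)

end MaxFlagA

namespace MaxFlagA

open scoped LinearAlgebra.Projectivization

variable {F : Type} [Field F] [Fintype F] {n : ℕ}

theorem eq_zero_or_of_oppA_eq (hn : 1 ≤ n) {v : MaxFlagA F n → ℝ} {l : ℝ}
    (hv : relOp OppA v = l • v) (hl : (Fintype.card F : ℝ) ^ ((n - 1) * (n + 1)) ≤ l ^ 2)
    (hl' : l ≠ (Fintype.card F : ℝ) ^ (n + 1).choose 2) :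
    v ∈ pointSpace F n ∧ (v = 0 ∨ l ^ 2 = (Fintype.card F : ℝ) ^ ((n - 1) * (n + 1))) := by
  have hq := q_pos F
  obtain ⟨w, hwC, u, hu, rfl⟩ := exists_add_of_orth v
  have hu0 : u = 0 := by
    by_contra hu0
    refine (sq_lt_of_mem_orth hu hu0 (l := l) ?_).not_ge hl
    rw [← sub_eq_zero]
    refine eq_zero_of_mem_pointSpaceC_of_mem_orth ?_ (sub_mem (relOp_mem_orth
      (fun _ _ => oppA_symm) (fun _ => oppA_mem_pointSpaceC) hu) (Submodule.smul_mem _ _ hu))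
    have h1 : relOp OppA u - l • u = l • w - relOp OppA w := by
      rw [map_add, smul_add] at hv
      rw [sub_eq_sub_iff_add_eq_add, add_comm, hv, add_comm]
    rw [h1]
    exact sub_mem (Submodule.smul_mem _ _ hwC) (oppA_mem_pointSpaceC hwC)
  subst hu0
  obtain ⟨w, hw, c, rfl⟩ := mem_pointSpaceC.1 hwC
  rw [add_zero] at hv ⊢
  set M := (Fintype.card F : ℝ) ^ ((n - 1) * (n + 1)) with hM
  set T := (Fintype.card F : ℝ) ^ (n + 1).choose 2 with hT
  have h2 : (l ^ 2 - M) • w = ((T ^ 2 - l ^ 2) * c) • (1 : MaxFlagA F n → ℝ) := by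
    have h3 : relOp OppA (relOp OppA (w + c • 1)) = M • w + c • T • T • 1 := by
      rw [map_add, map_add, oppA_oppA_of_mem_pointSpace hn hw, map_smul, oppA_one, map_smul,
        map_smul, oppA_one]
    rw [hv, map_smul, hv] at h3
    rw [← sub_eq_zero] at h3 ⊢
    rw [← h3]
    module
  by_cases hlM : l ^ 2 = M
  · refine ⟨?_, Or.inr hlM⟩
    have hMT : M < T ^ 2 := by
      rw [hM, hT, ← pow_mul, mul_two, two_mul_choose_two]
      refine pow_lt_pow_right₀ (one_lt_q F) ?_
      exact Nat.mul_lt_mul_of_pos_right (by omega) (by omega)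
    have hc : c = 0 := by
      have h3 := congrFun h2 (Classical.arbitrary _)
      simp only [hlM, sub_self, Pi.smul_apply, Pi.one_apply, smul_eq_mul, zero_mul, mul_one] at h3
      exact (mul_eq_zero.1 h3.symm).resolve_left (sub_pos.2 hMT).ne'
    rwa [hc, zero_smul, add_zero]
  · have h3 : ∃ d : ℝ, w + c • 1 = d • (1 : MaxFlagA F n → ℝ) := by
      refine ⟨(l ^ 2 - M)⁻¹ * ((T ^ 2 - l ^ 2) * c) + c, ?_⟩
      rw [add_smul, mul_smul, ← h2, inv_smul_smul₀ (sub_ne_zero.2 hlM)]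
    obtain ⟨d, hd⟩ := h3
    have h4 : w + c • (1 : MaxFlagA F n → ℝ) = 0 := by
      rw [hd, map_smul, oppA_one, smul_comm, ← sub_eq_zero, ← sub_smul] at hv
      rw [hd]
      exact (smul_eq_zero.1 hv).resolve_left (sub_ne_zero.2 hl'.symm)
    rw [h4]
    exact ⟨zero_mem _, Or.inl rfl⟩

/-- The combination of `pointSum k f` and `pointSum (n + 1 - k) f` which is an eigenvector of the
opposition graph for the eigenvalue `-μ`. -/
noncomputable def eigenMap (F : Type) [Field F] [Fintype F] (n : ℕ) (μ : ℝ) (k : ℕ) :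
    (ℙ F (Fin (n + 1) → F) → ℝ) →ₗ[ℝ] (MaxFlagA F n → ℝ) :=
  μ • pointSum k + oppScalar F n k • pointSum (n + 1 - k)

theorem eigenMap_apply (μ : ℝ) (k : ℕ) (f : ℙ F (Fin (n + 1) → F) → ℝ) :
    eigenMap F n μ k f = μ • pointSum k f + oppScalar F n k • pointSum (n + 1 - k) f := rfl

theorem smul_sub_oppA_pointSum {k : ℕ} (hk : k ≤ n + 1) (μ : ℝ)
    {f : ℙ F (Fin (n + 1) → F) → ℝ} (hf : f ∈ sumZero F n) :
    μ • pointSum k f - relOp OppA (pointSum k f) = eigenMap F n μ k f := by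
  rw [oppA_pointSum hk hf, eigenMap_apply, neg_smul, sub_neg_eq_add]

theorem oppA_eigenMap (hn : 1 ≤ n) {k : ℕ} (hk : k ≤ n + 1) {μ : ℝ}
    (hμ : μ ^ 2 = (Fintype.card F : ℝ) ^ ((n - 1) * (n + 1)))
    {f : ℙ F (Fin (n + 1) → F) → ℝ} (hf : f ∈ sumZero F n) :
    relOp OppA (eigenMap F n μ k f) = -μ • eigenMap F n μ k f := by
  rw [← smul_sub_oppA_pointSum hk μ hf, map_sub, map_smul,
    oppA_oppA_of_mem_pointSpace hn (pointSum_mem k hf), ← hμ]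
  module

theorem eigenMap_swap (hn : 1 ≤ n) {k : ℕ} (hk : k ≤ n + 1) {μ : ℝ} (hμ0 : μ ≠ 0)
    (hμ : μ ^ 2 = (Fintype.card F : ℝ) ^ ((n - 1) * (n + 1)))
    (f : ℙ F (Fin (n + 1) → F) → ℝ) :
    eigenMap F n μ k f = (oppScalar F n k / μ) • eigenMap F n μ (n + 1 - k) f := by
  have h := oppScalar_mul (F := F) hn hk
  rw [eigenMap_apply, eigenMap_apply, smul_add, smul_smul, smul_smul, div_mul_cancel₀ _ hμ0,
    Nat.sub_sub_self hk, div_mul_eq_mul_div, h, ← hμ, sq, mul_div_cancel_right₀ _ hμ0, add_comm]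

/-- The difference of `panelOp F n (i + 1)` and its eigenvalue on functions constant on panels. -/
noncomputable def panelDiff (F : Type) [Field F] [Fintype F] (n i : ℕ) :
    Module.End ℝ (MaxFlagA F n → ℝ) :=
  panelOp F n (i + 1) - ((Fintype.card F : ℝ) + 1) • 1

theorem panelDiff_of_ne {i j : ℕ} (hi : i < n) (hj : j ≠ i + 1)
    (f : ℙ F (Fin (n + 1) → F) → ℝ) : panelDiff F n i (pointSum j f) = 0 := by
  simp [panelDiff, panelOp_pointSum_of_ne hi hj]

theorem panelDiff_self {i : ℕ} (hi : i < n) (f : ℙ F (Fin (n + 1) → F) → ℝ) :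
    panelDiff F n i (pointSum (i + 1) f) = pointSum (i + 2) f +
      (Fintype.card F : ℝ) • pointSum i f - ((Fintype.card F : ℝ) + 1) • pointSum (i + 1) f := by
  simp [panelDiff, panelOp_pointSum_self hi]

theorem eq_zero_of_panelDiff_eq_zero {i : ℕ} (hi : i < n) {f : ℙ F (Fin (n + 1) → F) → ℝ}
    (hf : f ∈ sumZero F n) (h : panelDiff F n i (pointSum (i + 1) f) = 0) : f = 0 := by
  have hq := q_pos F
  have up : ∀ j, j + 1 < n → panelDiff F n j (pointSum (j + 1) f) = 0 →
      panelDiff F n (j + 1) (pointSum (j + 2) f) = 0 := by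
    intro j hj h0
    rw [panelDiff_self (by omega)] at h0
    have h1 := congrArg (panelDiff F n (j + 1)) h0
    rwa [map_sub, map_add, map_smul, map_smul, panelDiff_of_ne (j := j) hj (by omega),
      panelDiff_of_ne (j := j + 1) hj (by omega), smul_zero, smul_zero, add_zero, _root_.sub_zero,
      map_zero] at h1
  have down : ∀ j, j + 1 < n → panelDiff F n (j + 1) (pointSum (j + 2) f) = 0 →
      panelDiff F n j (pointSum (j + 1) f) = 0 := by
    intro j hj h0
    rw [panelDiff_self (by omega)] at h0
    have h1 := congrArg (panelDiff F n j) h0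
    rw [map_sub, map_add, map_smul, map_smul, panelDiff_of_ne (j := j + 1 + 2) (by omega) (by omega),
      panelDiff_of_ne (j := j + 1 + 1) (by omega) (by omega), smul_zero, zero_add, _root_.sub_zero,
      map_zero] at h1
    exact (smul_eq_zero.1 h1).resolve_left hq.ne'
  have h0 : panelDiff F n 0 (pointSum 1 f) = 0 := by
    induction i with
    | zero => exact h
    | succ i ih => exact ih (by omega) (down i hi h)
  have hall : ∀ j < n, panelDiff F n j (pointSum (j + 1) f) = 0 := by
    intro j
    induction j with
    | zero => exact fun _ => h0
    | succ j ih => exact fun hj => up j hj (ih (by omega))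
  have hstep : ∀ j ≤ n, pointSum (j + 1) f - pointSum j f =
      (Fintype.card F : ℝ) ^ j • pointSum 1 f := by
    intro j
    induction j with
    | zero => simp [pointSum_zero]
    | succ j ih =>
      intro hj
      have h1 := hall j hj
      rw [panelDiff_self hj] at h1
      rw [pow_succ', mul_smul, ← ih (by omega), ← sub_eq_zero, ← h1]
      module
  have hsum : ∀ j ≤ n + 1, pointSum j f =
      (∑ k ∈ Finset.range j, (Fintype.card F : ℝ) ^ k) • pointSum 1 f := by
    intro j
    induction j with
    | zero => simp [pointSum_zero]
    | succ j ih =>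
      intro hj
      rw [Finset.sum_range_succ, add_smul, ← ih (by omega), ← hstep j (by omega)]
      abel
  have h1 := hsum (n + 1) le_rfl
  rw [pointSum_of_lt (Nat.lt_succ_self n) hf, eq_comm] at h1
  have h2 : pointSum 1 f = 0 := by
    refine (smul_eq_zero.1 h1).resolve_left (ne_of_gt ?_)
    exact Finset.sum_pos (fun k _ => pow_pos hq k) ⟨0, by simp⟩
  funext p
  obtain ⟨x, hx⟩ := exists_sub_one_eq p
  rw [← pointSum_one_eq hx f, h2]
  rfl

/-- The sum of the maps `eigenMap F n μ k` for `1 ≤ k ≤ (n + 1) / 2`. -/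
noncomputable def eigenSum (F : Type) [Field F] [Fintype F] (n : ℕ) (μ : ℝ) :
    (Fin ((n + 1) / 2) → sumZero F n) →ₗ[ℝ] (MaxFlagA F n → ℝ) :=
  ∑ i : Fin ((n + 1) / 2),
    eigenMap F n μ (i + 1) ∘ₗ (sumZero F n).subtype ∘ₗ LinearMap.proj i

theorem eigenSum_apply (μ : ℝ) (g : Fin ((n + 1) / 2) → sumZero F n) :
    eigenSum F n μ g = ∑ i : Fin ((n + 1) / 2), eigenMap F n μ (i + 1) (g i) := by
  simp [eigenSum]

theorem eigenSum_injective {μ : ℝ} (hμ : 0 < μ) : Function.Injective (eigenSum F n μ) := by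
  rw [← LinearMap.ker_eq_bot, eq_bot_iff]
  intro g hg
  rw [LinearMap.mem_ker, eigenSum_apply] at hg
  rw [Submodule.mem_bot]
  funext i
  have hin : (i : ℕ) < n := by omega
  have h1 := congrArg (panelDiff F n i) hg
  rw [map_sum, Finset.sum_eq_single i, map_zero, eigenMap_apply, map_add, map_smul, map_smul] at h1
  · refine Subtype.ext (eq_zero_of_panelDiff_eq_zero hin (g i).2 ?_)
    by_cases h : n + 1 - (i + 1) = (i : ℕ) + 1
    · rw [h, ← add_smul] at h1
      exact (smul_eq_zero.1 h1).resolve_left (add_pos hμ (oppScalar_pos _)).ne'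
    · rw [panelDiff_of_ne hin h, smul_zero, add_zero] at h1
      exact (smul_eq_zero.1 h1).resolve_left hμ.ne'
  · intro j _ hj
    have hj' : (j : ℕ) ≠ i := fun h => hj (Fin.ext h)
    rw [eigenMap_apply, map_add, map_smul, map_smul, panelDiff_of_ne hin (by omega),
      panelDiff_of_ne hin (by omega), smul_zero, smul_zero, add_zero]
  · simp

theorem eigenMap_mem_range (hn : 1 ≤ n) {k : ℕ} (hk : 1 ≤ k) (hk' : k ≤ n) {μ : ℝ} (hμ0 : μ ≠ 0)
    (hμ : μ ^ 2 = (Fintype.card F : ℝ) ^ ((n - 1) * (n + 1)))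
    {f : ℙ F (Fin (n + 1) → F) → ℝ} (hf : f ∈ sumZero F n) :
    eigenMap F n μ k f ∈ LinearMap.range (eigenSum F n μ) := by
  classical
  have key : ∀ j < (n + 1) / 2, eigenMap F n μ (j + 1) f ∈ LinearMap.range (eigenSum F n μ) := by
    intro j hj
    refine ⟨Pi.single ⟨j, hj⟩ ⟨f, hf⟩, ?_⟩
    rw [eigenSum_apply, Finset.sum_eq_single ⟨j, hj⟩]
    · simp
    · intro i _ hi
      simp [Pi.single_eq_of_ne hi]
    · simp
  obtain ⟨j, rfl⟩ := Nat.exists_eq_add_of_le' hk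
  by_cases h : j < (n + 1) / 2
  · exact key j h
  · rw [eigenMap_swap hn (by omega) hμ0 hμ]
    have h1 := key (n - j - 1) (by omega)
    rw [show n - j - 1 + 1 = n + 1 - (j + 1) by omega] at h1
    exact Submodule.smul_mem _ _ h1

theorem range_eigenSum (hn : 1 ≤ n) {μ : ℝ} (hμ0 : 0 < μ)
    (hμ : μ ^ 2 = (Fintype.card F : ℝ) ^ ((n - 1) * (n + 1))) :
    LinearMap.range (eigenSum F n μ) = Module.End.eigenspace (relOp OppA) (-μ) := by
  apply le_antisymm
  · rintro _ ⟨g, rfl⟩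
    rw [Module.End.mem_eigenspace_iff, eigenSum_apply, map_sum, Finset.smul_sum]
    exact Finset.sum_congr rfl fun i _ => oppA_eigenMap hn (by omega) hμ (g i).2
  · intro v hv
    rw [Module.End.mem_eigenspace_iff] at hv
    have h1 := (eq_zero_or_of_oppA_eq hn hv (by rw [neg_sq, hμ])
      (((neg_neg_of_pos hμ0).trans (pow_pos (q_pos F) _)).ne)).1
    have h2 : μ • v - relOp OppA v ∈ LinearMap.range (eigenSum F n μ) := by
      refine pointSpace_le (p := (LinearMap.range (eigenSum F n μ)).comap (μ • 1 - relOp OppA))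
        (fun k hk hk' f hf => ?_) h1
      rw [Submodule.mem_comap, LinearMap.sub_apply, LinearMap.smul_apply, Module.End.one_apply,
        smul_sub_oppA_pointSum (by omega) μ hf]
      exact eigenMap_mem_range hn hk hk' hμ0.ne' hμ hf
    rw [hv, neg_smul, sub_neg_eq_add, ← add_smul] at h2
    exact (Submodule.smul_mem_iff _ (add_pos hμ0 hμ0).ne').1 h2

theorem finrank_eigenspace (hn : 1 ≤ n) {μ : ℝ} (hμ0 : 0 < μ)
    (hμ : μ ^ 2 = (Fintype.card F : ℝ) ^ ((n - 1) * (n + 1))) :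
    Module.finrank ℝ (Module.End.eigenspace (relOp (OppA (F := F) (n := n))) (-μ)) =
      (n + 1) / 2 * Module.finrank ℝ (sumZero F n) := by
  rw [← range_eigenSum hn hμ0 hμ, LinearMap.finrank_range_of_inj (eigenSum_injective hμ0),
    Module.finrank_pi_fintype]
  simp

theorem mulVecLin_adjA : (adjA F n).mulVecLin = relOp OppA := by
  classical
  refine LinearMap.ext fun v => ?_
  funext x
  rw [Matrix.mulVecLin_apply, relOp_apply, Finset.sum_filter]
  simp [Matrix.mulVec, dotProduct, adjA]

theorem finrank_sumZero_mul :
    (Module.finrank ℝ (sumZero F n) : ℚ) * ((Fintype.card F : ℚ) - 1) =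
      (Fintype.card F : ℚ) ^ (n + 1) - Fintype.card F := by
  have h1 := Projectivization.card' F (Fin (n + 1) → F)
  rw [← finrank_sumZero, Nat.card_fun, Nat.card_fin, Nat.card_eq_fintype_card] at h1
  obtain ⟨r, hr⟩ := Nat.exists_eq_add_of_le' (Fintype.card_pos (α := F))
  rw [hr, Nat.add_sub_cancel] at h1
  rw [hr]
  have h2 := congrArg (Nat.cast : ℕ → ℚ) h1
  push_cast at h2 ⊢
  linear_combination -h2

end MaxFlagA

open MaxFlagA

/-- The smallest eigenvalue of the opposition graph on maximal flags of `F_q^(n+1)` is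
`-q^((n²-1)/2)` (a real power of `q`), with eigenspace of dimension
`⌈n/2⌉·(q^(n+1)-q)/(q-1)`. -/
theorem opposition_graph_smallest_eigenvalue (F : Type) [Field F] [Fintype F] (q : ℕ)
    (hq : Fintype.card F = q) (n : ℕ) (hn : 1 ≤ n) :
    (∃ v : MaxFlagA F n → ℝ, v ≠ 0 ∧
        (adjA F n).mulVec v = (-((q : ℝ) ^ ((((n : ℝ)) ^ 2 - 1) / 2))) • v) ∧
    (∀ μ : ℝ, (∃ v : MaxFlagA F n → ℝ, v ≠ 0 ∧ (adjA F n).mulVec v = μ • v) →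
        -((q : ℝ) ^ ((((n : ℝ)) ^ 2 - 1) / 2)) ≤ μ) ∧
    ((Module.finrank ℝ
        (Module.End.eigenspace (adjA F n).mulVecLin
          (-((q : ℝ) ^ ((((n : ℝ)) ^ 2 - 1) / 2)))) : ℚ) =
      (⌈(n : ℚ) / 2⌉ : ℚ) * (((q : ℚ) ^ (n + 1) - q) / ((q : ℚ) - 1))) := by
  subst hq
  set μ : ℝ := (Fintype.card F : ℝ) ^ ((((n : ℝ)) ^ 2 - 1) / 2) with hμdef
  have hμ0 : 0 < μ := Real.rpow_pos_of_pos (q_pos F) _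
  have hμ : μ ^ 2 = (Fintype.card F : ℝ) ^ ((n - 1) * (n + 1)) := by
    have h : (((n : ℝ) ^ 2 - 1) / 2) * (2 : ℕ) = ((n - 1) * (n + 1) : ℕ) := by
      push_cast [Nat.cast_sub hn]
      ring
    rw [hμdef, ← Real.rpow_mul_natCast (q_pos F).le, h, Real.rpow_natCast]
  have hdim := finrank_eigenspace hn hμ0 hμ
  have hmul := finrank_sumZero_mul (F := F) (n := n)
  have hqQ : (1 : ℚ) < Fintype.card F := by exact_mod_cast Fintype.one_lt_card
  refine ⟨?_, ?_, ?_⟩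
  · have hpos : 0 < Module.finrank ℝ (sumZero F n) := by
      refine Nat.pos_of_ne_zero fun h => ?_
      rw [h, Nat.cast_zero, zero_mul] at hmul
      have := pow_lt_pow_right₀ hqQ (show 1 < n + 1 by omega)
      rw [pow_one] at this
      exact (sub_pos.2 this).ne hmul
    have hne : Module.End.eigenspace (relOp (OppA (F := F) (n := n))) (-μ) ≠ ⊥ := by
      rw [← Submodule.one_le_finrank_iff, hdim]
      exact Nat.mul_pos (by omega) hpos
    obtain ⟨v, hv, hv0⟩ := Submodule.exists_mem_ne_zero_of_ne_bot hne
    refine ⟨v, hv0, ?_⟩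
    rw [← Matrix.mulVecLin_apply, mulVecLin_adjA]
    exact Module.End.mem_eigenspace_iff.1 hv
  · rintro l ⟨v, hv0, hv⟩
    rw [← Matrix.mulVecLin_apply, mulVecLin_adjA] at hv
    by_contra! hl
    have hsq : μ ^ 2 < l ^ 2 := by nlinarith
    rw [hμ] at hsq
    rcases (eq_zero_or_of_oppA_eq hn hv hsq.le
      ((hl.trans (neg_neg_of_pos hμ0)).trans (pow_pos (q_pos F) _)).ne).2 with h | h
    · exact hv0 h
    · exact hsq.ne' h
  · rw [mulVecLin_adjA, hdim, ← hmul, mul_div_cancel_right₀ _ (sub_pos.2 hqQ).ne', Nat.cast_mul]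
    congr 1
    have h : ⌈(n : ℚ) / 2⌉ = (((n + 1) / 2 : ℕ) : ℤ) := by
      rw [Int.ceil_eq_iff]
      rcases Nat.even_or_odd' n with ⟨k, rfl | rfl⟩
      · rw [show (2 * k + 1) / 2 = k by omega]
        push_cast
        constructor <;> linarith
      · rw [show (2 * k + 1 + 1) / 2 = k + 1 by omega]
        push_cast
        constructor <;> linarith
    rw [h, Int.cast_natCast]
end
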